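/- Let f and g be continuous real-valued functions on S³, odd with respect to 𝒪, and let ζ ∈ S³. Assume that for every w ∈ S²(ζ) there exists a rotation φ_w ∈ SO(3, S²(w)) with φ_w(ζ) = ±ζ such that f∘φ_w = g on S²(w). Then S²(ζ) = Ξ₀ ∪ Ξ₁ ∪ Ψ. -/

import Mathlib

noncomputable section

open scoped RealInnerProductSpace

/-- `ℝ⁴` as a Euclidean space. -/
abbrev E4 := EuclideanSpace ℝ (Fin 4)

/-- The unit sphere `S³` in `ℝ⁴`. -/
def sph : Set E4 := Metric.sphere (0 : E4) 1

/-- The great subsphere `S²(w) = {θ ∈ S³ : θ·w = 0}`. -/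
def S2 (w : E4) : Set E4 := {θ ∈ sph | ⟪θ, w⟫ = 0}

/-- The orthogonal transformation `𝒪` determined by `ζ`: for a unit vector `ζ` the map
`x ↦ 2⟪x,ζ⟫ζ - x` satisfies `𝒪 ζ = ζ` and `𝒪 = -I` on `ζ^⊥`. -/
def Ocal (ζ x : E4) : E4 := (2 * ⟪x, ζ⟫) • ζ - x

/-- `φ` is (the extension to `ℝ⁴` of) an element of `SO(3, S²(w))`:
a linear isometry of `ℝ⁴` fixing `w`, of determinant `1`, i.e. a rotation
of the `3`-dimensional subspace `w^⊥`. -/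
def IsRot (w : E4) (φ : E4 ≃ₗᵢ[ℝ] E4) : Prop :=
  φ w = w ∧ LinearMap.det (φ.toLinearEquiv : E4 →ₗ[ℝ] E4) = 1

/-- `φ ∈ SO(3, S²(w))` is a rotation by the angle `α·π` around the axis `u ∈ S²(w)`:
it fixes `w` and `u`, and turns the plane orthogonal to `w` and `u` by the angle `α·π`. -/
def IsRotAngleAbout (w u : E4) (α : ℝ) (φ : E4 ≃ₗᵢ[ℝ] E4) : Prop :=
  IsRot w φ ∧ φ u = u ∧
    ∀ v : E4, ⟪v, w⟫ = 0 → ⟪v, u⟫ = 0 →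
      ⟪φ v, v⟫ = Real.cos (α * Real.pi) * ⟪v, v⟫

/-- The set `Ξ₀ = {w ∈ S²(ζ) : f = g on S²(w)}`. -/
def Xi0 (f g : E4 → ℝ) (ζ : E4) : Set E4 :=
  {w ∈ S2 ζ | ∀ θ ∈ S2 w, f θ = g θ}

/-- The set `Ξ₁ = {w ∈ S²(ζ) : f(θ) = g(𝒪θ) for all θ ∈ S²(w)}`. -/
def Xi1 (f g : E4 → ℝ) (ζ : E4) : Set E4 :=
  {w ∈ S2 ζ | ∀ θ ∈ S2 w, f θ = g (Ocal ζ θ)}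

/-- The set `Ψ`: directions `w ∈ S²(ζ)` admitting a rotation `φ ∈ SO(3, S²(w))` with
`φ ζ = -ζ` carrying `f` to `g` on `S²(w)`. -/
def Psi (f g : E4 → ℝ) (ζ : E4) : Set E4 :=
  {w ∈ S2 ζ | ∃ φ : E4 ≃ₗᵢ[ℝ] E4, IsRot w φ ∧ φ ζ = -ζ ∧ ∀ θ ∈ S2 w, f (φ θ) = g θ}

open MeasureTheory Set
open scoped Matrix

theorem integral_sqrt_sub_sq (k : ℝ) :
    ∫ x : ℝ, √(k - x ^ 2) = Real.pi / 2 * max k 0 := by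
  rcases le_or_gt k 0 with hk | hk
  · have h0 : ∀ x : ℝ, √(k - x ^ 2) = 0 := fun x => Real.sqrt_eq_zero_of_nonpos (by nlinarith)
    simp [h0, max_eq_right hk]
  · have h1 : ∫ x : ℝ, √(1 - x ^ 2) = Real.pi / 2 := by
      rw [← integral_sqrt_one_sub_sq]
      refine (intervalIntegral.integral_eq_integral_of_support_subset ?_).symm
      intro x hx
      have hx' : 0 < 1 - x ^ 2 := by
        by_contra hneg
        exact hx (Real.sqrt_eq_zero_of_nonpos (not_lt.1 hneg))
      constructor <;> nlinarith
    have hs : 0 < √k := Real.sqrt_pos.2 hk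
    have hs2 : √k ^ 2 = k := Real.sq_sqrt hk.le
    have h2 := MeasureTheory.Measure.integral_comp_mul_left (fun x : ℝ => √(k - x ^ 2)) (√k)
    have h3 : ∀ x : ℝ, √(k - (√k * x) ^ 2) = √k * √(1 - x ^ 2) := by
      intro x
      rw [mul_pow, hs2, ← Real.sqrt_mul hk.le]
      ring_nf
    simp only [h3, MeasureTheory.integral_const_mul, h1, smul_eq_mul, abs_inv, abs_of_pos hs] at h2
    rw [max_eq_left hk.le]
    field_simp at h2
    rw [hs2] at h2
    linarith

/-- If the averages of `A` over the heights of all circles of radius at most `1` vanish, then so do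
the weighted integrals of `A` over symmetric intervals. -/
theorem integral_weight_eq_zero (A : ℝ → ℝ) (hA : Continuous A)
    (h : ∀ r ∈ Icc (0 : ℝ) 1, ∫ φ in (0 : ℝ)..(2 * Real.pi), A (r * Real.sin φ) = 0)
    (s : ℝ) (hs : s ∈ Icc (0 : ℝ) 1) :
    ∫ y : ℝ, A y * max (s ^ 2 - y ^ 2) 0 = 0 := by
  set F : ℝ × ℝ → ℝ := fun p => A p.2 * √(s ^ 2 - p.1 ^ 2 - p.2 ^ 2) with hF
  have hFc : Continuous F := by fun_prop
  have hFs : HasCompactSupport F := by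
    refine HasCompactSupport.of_support_subset_isCompact
      ((isCompact_Icc (a := -s) (b := s)).prod (isCompact_Icc (a := -s) (b := s))) ?_
    intro p hp
    have hp' : 0 < s ^ 2 - p.1 ^ 2 - p.2 ^ 2 := by
      by_contra hneg
      exact hp (by simp [hF, Real.sqrt_eq_zero_of_nonpos (not_lt.1 hneg)])
    have h1 : |p.1| ≤ s := abs_le_of_sq_le_sq (by nlinarith [sq_nonneg p.2]) hs.1
    have h2 : |p.2| ≤ s := abs_le_of_sq_le_sq (by nlinarith [sq_nonneg p.1]) hs.1
    exact ⟨abs_le.1 h1, abs_le.1 h2⟩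
  have hFi : Integrable F (volume.prod volume) := hFc.integrable_of_hasCompactSupport hFs
  have e1 : ∫ p, F p = ∫ y : ℝ, A y * (Real.pi / 2 * max (s ^ 2 - y ^ 2) 0) := by
    rw [Measure.volume_eq_prod, integral_prod_symm F hFi]
    refine integral_congr_ae (Filter.Eventually.of_forall fun y => ?_)
    have : ∀ x : ℝ, F (x, y) = A y * √((s ^ 2 - y ^ 2) - x ^ 2) := fun x => by
      simp only [hF]; ring_nf
    simp only [this, integral_const_mul, integral_sqrt_sub_sq]
  have e2 : ∫ p, F p = 0 := by
    rw [← integral_comp_polarCoord_symm F]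
    set H : ℝ × ℝ → ℝ := fun p => p.1 * √(s ^ 2 - p.1 ^ 2) * A (p.1 * Real.sin p.2) with hH
    have hcongr : ∀ p : ℝ × ℝ, p.1 • F (polarCoord.symm p) = H p := by
      intro p
      have : s ^ 2 - (p.1 * Real.cos p.2) ^ 2 - (p.1 * Real.sin p.2) ^ 2 = s ^ 2 - p.1 ^ 2 := by
        linear_combination -p.1 ^ 2 * Real.sin_sq_add_cos_sq p.2
      simp only [hF, hH, polarCoord_symm_apply, this, smul_eq_mul]
      ring
    have hHi : IntegrableOn H (Ioi 0 ×ˢ Ioo (-Real.pi) Real.pi) (volume.prod volume) := by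
      have hc : Continuous H := by fun_prop
      refine IntegrableOn.of_forall_sdiff_eq_zero
        (s := Icc 0 s ×ˢ Icc (-Real.pi) Real.pi) ?_
        (measurableSet_Ioi.prod measurableSet_Ioo) ?_
      · exact hc.continuousOn.integrableOn_compact (isCompact_Icc.prod isCompact_Icc)
      · rintro ⟨r, φ⟩ ⟨⟨hr, hφ⟩, hn⟩
        have hrs : s < r := by
          by_contra hle
          exact hn ⟨⟨le_of_lt hr, not_lt.1 hle⟩, Ioo_subset_Icc_self hφ⟩
        have : √(s ^ 2 - r ^ 2) = 0 := Real.sqrt_eq_zero_of_nonpos (by nlinarith [hs.1])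
        simp [hH, this]
    simp only [hcongr]
    rw [polarCoord_target, Measure.volume_eq_prod, setIntegral_prod H hHi]
    refine setIntegral_eq_zero_of_forall_eq_zero fun r hr => ?_
    simp only [hH, integral_const_mul]
    rcases le_or_gt r 1 with hr1 | hr1
    · have hper : Function.Periodic (fun φ => A (r * Real.sin φ)) (2 * Real.pi) := fun φ => by
        simp [Real.sin_add_two_pi]
      have := hper.intervalIntegral_add_eq (-Real.pi) 0
      rw [zero_add, h r ⟨le_of_lt hr, hr1⟩] at this
      have e : -Real.pi + 2 * Real.pi = Real.pi := by ring
      rw [e, intervalIntegral.integral_of_le (by linarith [Real.pi_pos]),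
        integral_Ioc_eq_integral_Ioo] at this
      rw [this, mul_zero]
    · have : √(s ^ 2 - r ^ 2) = 0 :=
        Real.sqrt_eq_zero_of_nonpos (by nlinarith [hs.1, hs.2])
      simp [this]
  have e3 : ∫ y : ℝ, A y * (Real.pi / 2 * max (s ^ 2 - y ^ 2) 0)
      = Real.pi / 2 * ∫ y : ℝ, A y * max (s ^ 2 - y ^ 2) 0 := by
    rw [← integral_const_mul]
    congr 1
    ext y
    ring
  rw [e1, e3] at e2
  exact (mul_eq_zero.1 e2).resolve_left (by positivity)

/-- Abel inversion at the endpoint. -/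
theorem add_neg_eq_zero_of_circle_averages (A : ℝ → ℝ) (hA : Continuous A)
    (h : ∀ r ∈ Icc (0 : ℝ) 1, ∫ φ in (0 : ℝ)..(2 * Real.pi), A (r * Real.sin φ) = 0) :
    A 1 + A (-1) = 0 := by
  set B : ℝ → ℝ := fun y => A y + A (-y) with hB
  have hBc : Continuous B := by fun_prop
  have hP : ∀ s ∈ Icc (0 : ℝ) 1, ∫ y in (0 : ℝ)..s, B y * (s ^ 2 - y ^ 2) = 0 := by
    intro s hs
    have h1 := integral_weight_eq_zero A hA h s hs
    have h2 : ∫ y in (-s)..s, A y * max (s ^ 2 - y ^ 2) 0 = 0 := by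
      refine (intervalIntegral.integral_eq_integral_of_support_subset ?_).trans h1
      intro y hy
      have hy' : 0 < s ^ 2 - y ^ 2 := by
        by_contra hneg
        exact hy (by simp [max_eq_right (not_lt.1 hneg)])
      have := abs_lt_of_sq_lt_sq (by linarith : y ^ 2 < s ^ 2) hs.1
      exact ⟨(abs_lt.1 this).1, (abs_lt.1 this).2.le⟩
    have h3 : ∫ y in (-s)..s, A y * (s ^ 2 - y ^ 2) = 0 := by
      refine (intervalIntegral.integral_congr fun y hy => ?_).trans h2
      rw [uIcc_of_le (by linarith [hs.1])] at hy
      have : 0 ≤ s ^ 2 - y ^ 2 := by nlinarith [hy.1, hy.2]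
      simp [max_eq_left this]
    have hc : Continuous fun y => A y * (s ^ 2 - y ^ 2) := by fun_prop
    have hc' : Continuous fun y => A (-y) * (s ^ 2 - y ^ 2) := by fun_prop
    rw [← intervalIntegral.integral_add_adjacent_intervals (b := 0)
      (hc.intervalIntegrable _ _) (hc.intervalIntegrable _ _)] at h3
    have h4 := intervalIntegral.integral_comp_neg (a := 0) (b := s)
      (fun y : ℝ => A y * (s ^ 2 - y ^ 2))
    simp only [neg_zero, neg_sq] at h4
    rw [← h4, ← intervalIntegral.integral_add (hc'.intervalIntegrable _ _)
      (hc.intervalIntegrable _ _)] at h3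
    refine Eq.trans (intervalIntegral.integral_congr fun y _ => ?_) h3
    simp only [hB]
    ring
  set I : ℝ → ℝ := fun s => ∫ y in (0 : ℝ)..s, B y with hI
  set J : ℝ → ℝ := fun s => ∫ y in (0 : ℝ)..s, B y * y ^ 2 with hJ
  have hId : ∀ s, HasDerivAt I (B s) s := fun s =>
    (hBc.integral_hasStrictDerivAt 0 s).hasDerivAt
  have hBc2 : Continuous fun y => B y * y ^ 2 := by fun_prop
  have hJd : ∀ s, HasDerivAt J (B s * s ^ 2) s := fun s =>
    (hBc2.integral_hasStrictDerivAt 0 s).hasDerivAt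
  have hIJ : ∀ s ∈ Icc (0 : ℝ) 1, s ^ 2 * I s - J s = 0 := by
    intro s hs
    rw [← hP s hs, hI, hJ, ← intervalIntegral.integral_const_mul, ← intervalIntegral.integral_sub
      ((hBc.const_mul _).intervalIntegrable _ _) (hBc2.intervalIntegrable _ _)]
    refine intervalIntegral.integral_congr fun y _ => ?_
    ring
  have hI0 : ∀ s ∈ Ioo (0 : ℝ) 1, I s = 0 := by
    intro s hs
    have hd : HasDerivAt (fun s => s ^ 2 * I s - J s)
        ((2 * s) * I s + s ^ 2 * B s - B s * s ^ 2) s := by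
      have := (((hasDerivAt_id s).pow 2).mul (hId s)).sub (hJd s)
      convert! this using 1
      simp
    have hz : HasDerivAt (fun s => s ^ 2 * I s - J s) 0 s := by
      refine (hasDerivAt_const s (0 : ℝ)).congr_of_eventuallyEq ?_
      filter_upwards [Ioo_mem_nhds hs.1 hs.2] with t ht using hIJ t (Ioo_subset_Icc_self ht)
    have := hd.unique hz
    have h2 : s * I s = 0 := by linarith
    exact (mul_eq_zero.1 h2).resolve_left hs.1.ne'
  have hB0 : ∀ s ∈ Ioo (0 : ℝ) 1, B s = 0 := by
    intro s hs
    refine (hId s).unique ((hasDerivAt_const s (0 : ℝ)).congr_of_eventuallyEq ?_)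
    filter_upwards [Ioo_mem_nhds hs.1 hs.2] with t ht using hI0 t ht
  have hcl : closure (Ioo (0 : ℝ) 1) ⊆ {s | B s = 0} :=
    closure_minimal hB0 (isClosed_eq hBc continuous_const)
  have := hcl (by rw [closure_Ioo (by norm_num)]; norm_num : (1 : ℝ) ∈ closure (Ioo (0 : ℝ) 1))
  exact this

theorem exists_polar (x y : ℝ) :
    ∃ δ : ℝ, x = √(x ^ 2 + y ^ 2) * Real.cos δ ∧ y = √(x ^ 2 + y ^ 2) * Real.sin δ := by
  refine ⟨Complex.arg ⟨x, y⟩, ?_, ?_⟩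
  · have := Complex.norm_mul_cos_arg ⟨x, y⟩
    rw [Complex.norm_eq_sqrt_sq_add_sq] at this
    exact this.symm
  · have := Complex.norm_mul_sin_arg ⟨x, y⟩
    rw [Complex.norm_eq_sqrt_sq_add_sq] at this
    exact this.symm

theorem exists_unit_orthogonal (p : Fin 3 → ℝ) :
    ∃ e : Fin 3 → ℝ, e ⬝ᵥ e = 1 ∧ p ⬝ᵥ e = 0 := by
  by_cases h : p 0 ^ 2 + p 1 ^ 2 = 0
  · refine ⟨![1, 0, 0], by simp, ?_⟩
    have : p 0 = 0 := by nlinarith [sq_nonneg (p 0), sq_nonneg (p 1)]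
    rw [Matrix.vec3_dotProduct]
    simp [this]
  · have hpos : 0 < p 0 ^ 2 + p 1 ^ 2 := lt_of_le_of_ne (by positivity) (Ne.symm h)
    have hs := Real.sq_sqrt hpos.le
    have hs0 := (Real.sqrt_pos.2 hpos).ne'
    refine ⟨![-p 1 / √(p 0 ^ 2 + p 1 ^ 2), p 0 / √(p 0 ^ 2 + p 1 ^ 2), 0], ?_, ?_⟩
    · simp only [Matrix.vec3_dotProduct, Matrix.cons_val]
      field_simp
      rw [hs]
      ring
    · simp only [Matrix.vec3_dotProduct, Matrix.cons_val]
      ring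

/-- Injectivity of the Funk transform on even continuous functions on the unit sphere of `ℝ³`. -/
theorem eq_zero_of_circle_integrals_eq_zero (a : (Fin 3 → ℝ) → ℝ) (ha : Continuous a)
    (hev : ∀ x, x ⬝ᵥ x = 1 → a (-x) = a x)
    (h : ∀ u v : Fin 3 → ℝ, u ⬝ᵥ u = 1 → v ⬝ᵥ v = 1 → u ⬝ᵥ v = 0 →
      ∫ τ in (0 : ℝ)..(2 * Real.pi), a (Real.cos τ • u + Real.sin τ • v) = 0)
    (p : Fin 3 → ℝ) (hp : p ⬝ᵥ p = 1) : a p = 0 := by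
  obtain ⟨e, he, hpe⟩ := exists_unit_orthogonal p
  set e' := p ⨯₃ e with he'
  have hee' : e ⬝ᵥ e' = 0 := dot_cross_self p e
  have hpe' : p ⬝ᵥ e' = 0 := dot_self_cross p e
  have he'1 : e' ⬝ᵥ e' = 1 := by
    rw [he', cross_dot_cross, dotProduct_comm e p, hp, he, hpe]; ring
  set A : ℝ → ℝ := fun z => ∫ ψ in (0 : ℝ)..(2 * Real.pi),
    a (√(1 - z ^ 2) • (Real.cos ψ • e + Real.sin ψ • e') + z • p) with hA
  have hAc : Continuous A := by
    refine intervalIntegral.continuous_parametric_intervalIntegral_of_continuous' ?_ _ _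
    simp only [Function.uncurry_def]
    fun_prop
  have hAz : A 1 + A (-1) = 0 := by
    refine add_neg_eq_zero_of_circle_averages A hAc fun r hr => ?_
    have hcb : √(1 - r ^ 2) ^ 2 = 1 - r ^ 2 := Real.sq_sqrt (by nlinarith [hr.1, hr.2])
    set c := √(1 - r ^ 2) with hc
    have key : ∀ φ : ℝ, A (r * Real.sin φ) = ∫ ψ in (0 : ℝ)..(2 * Real.pi),
        a (Real.cos φ • (Real.cos ψ • e + Real.sin ψ • e') +
          Real.sin φ • (c • (-Real.sin ψ • e + Real.cos ψ • e') + r • p)) := by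
      intro φ
      obtain ⟨δ, h1, h2⟩ := exists_polar (Real.cos φ) (Real.sin φ * c)
      have h3 : Real.cos φ ^ 2 + (Real.sin φ * c) ^ 2 = 1 - (r * Real.sin φ) ^ 2 := by
        rw [mul_pow, hcb]
        linear_combination Real.sin_sq_add_cos_sq φ
      rw [h3] at h1 h2
      set ρ := √(1 - (r * Real.sin φ) ^ 2) with hρ
      have h4 : ∀ ψ : ℝ, Real.cos φ • (Real.cos ψ • e + Real.sin ψ • e') +
          Real.sin φ • (c • (-Real.sin ψ • e + Real.cos ψ • e') + r • p) =
          ρ • (Real.cos (ψ + δ) • e + Real.sin (ψ + δ) • e') + (r * Real.sin φ) • p := by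
        intro ψ
        ext i
        simp only [Pi.add_apply, Pi.smul_apply, smul_eq_mul, Real.cos_add, Real.sin_add]
        linear_combination (Real.cos ψ * e i + Real.sin ψ * e' i) * h1 +
          (-Real.sin ψ * e i + Real.cos ψ * e' i) * h2
      simp only [h4]
      have hper : Function.Periodic (fun ψ => a (ρ • (Real.cos ψ • e + Real.sin ψ • e') +
          (r * Real.sin φ) • p)) (2 * Real.pi) := fun ψ => by
        simp [Real.sin_add_two_pi, Real.cos_add_two_pi]
      rw [intervalIntegral.integral_comp_add_right (fun ψ => a (ρ •
        (Real.cos ψ • e + Real.sin ψ • e') + (r * Real.sin φ) • p)) δ, zero_add,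
        add_comm (2 * Real.pi) δ, hper.intervalIntegral_add_eq δ 0, zero_add]
    simp only [key]
    rw [intervalIntegral_intervalIntegral_swap]
    · refine (intervalIntegral.integral_congr fun ψ _ => ?_).trans
        (intervalIntegral.integral_zero (a := (0 : ℝ)) (b := 2 * Real.pi))
      have hsc := Real.sin_sq_add_cos_sq ψ
      have he'e : e' ⬝ᵥ e = 0 := by rw [dotProduct_comm, hee']
      have hep : e ⬝ᵥ p = 0 := by rw [dotProduct_comm, hpe]
      have he'p : e' ⬝ᵥ p = 0 := by rw [dotProduct_comm, hpe']
      refine h _ _ ?_ ?_ ?_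
      all_goals
        simp only [dotProduct_add, add_dotProduct, dotProduct_smul, smul_dotProduct, smul_eq_mul,
          he, he'1, hp, hee', hpe, hpe', he'e, hep, he'p]
      · linear_combination hsc
      · linear_combination c ^ 2 * hsc + hcb
      · ring
    · refine IntegrableOn.mono_set (t := uIcc 0 (2 * Real.pi) ×ˢ uIcc 0 (2 * Real.pi)) ?_
        (prod_mono uIoc_subset_uIcc uIoc_subset_uIcc)
      refine ContinuousOn.integrableOn_compact (isCompact_uIcc.prod isCompact_uIcc) ?_
      refine Continuous.continuousOn ?_
      simp only [Function.uncurry_def]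
      fun_prop
  have hA1 : A 1 = 2 * Real.pi * a p := by simp [hA]
  have hA2 : A (-1) = 2 * Real.pi * a p := by simp [hA, hev p hp]
  have : 4 * Real.pi * a p = 0 := by linarith
  exact (mul_eq_zero.1 this).resolve_left (by positivity)

theorem continuousAt_cross {X : Type*} [TopologicalSpace X] {u v : X → Fin 3 → ℝ} {t : X}
    (hu : ContinuousAt u t) (hv : ContinuousAt v t) : ContinuousAt (fun x => u x ⨯₃ v x) t := by
  have hu' := fun i => continuousAt_pi.1 hu i
  have hv' := fun i => continuousAt_pi.1 hv i
  simp only [cross_apply]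
  refine continuousAt_pi.2 fun i => ?_
  fin_cases i <;> simp <;> fun_prop

theorem continuous_cross {X : Type*} [TopologicalSpace X] {u v : X → Fin 3 → ℝ}
    (hu : Continuous u) (hv : Continuous v) : Continuous fun x => u x ⨯₃ v x :=
  continuous_iff_continuousAt.2 fun _ => continuousAt_cross hu.continuousAt hv.continuousAt

/-- A vector making the angle `α` with two given unit vectors, in terms of these. -/
theorem eq_combination_of_dotProduct (x y z : Fin 3 → ℝ) (k : ℝ)
    (hy : y ⬝ᵥ y = 1) (hz : z ⬝ᵥ z = 1) (hxy : x ⬝ᵥ y = k) (hxz : x ⬝ᵥ z = k)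
    (hc : 1 - (y ⬝ᵥ z) ^ 2 ≠ 0) :
    x = (k / (1 + y ⬝ᵥ z)) • (y + z) + ((x ⬝ᵥ y ⨯₃ z) / (1 - (y ⬝ᵥ z) ^ 2)) • (y ⨯₃ z) := by
  have hc1 : 1 + y ⬝ᵥ z ≠ 0 := fun h => hc (by linear_combination (1 - y ⬝ᵥ z) * h)
  have hcc : (y ⨯₃ z) ⬝ᵥ (y ⨯₃ z) = 1 - (y ⬝ᵥ z) ^ 2 := by
    rw [cross_dot_cross, hy, hz, dotProduct_comm z y]; ring
  have hzy : z ⬝ᵥ y = y ⬝ᵥ z := dotProduct_comm z y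
  rw [← sub_eq_zero]
  have hM : Matrix.det ![y, z, y ⨯₃ z] ≠ 0 := by
    rw [← triple_product_eq_det, triple_product_permutation, triple_product_permutation, hcc]
    exact hc
  refine Matrix.eq_zero_of_mulVec_eq_zero hM ?_
  ext i
  fin_cases i
  · change y ⬝ᵥ _ = 0
    simp only [dotProduct_sub, dotProduct_add, dotProduct_smul, smul_eq_mul, hy, dot_self_cross,
      dotProduct_comm y x, hxy]
    field_simp
    ring
  · change z ⬝ᵥ _ = 0
    simp only [dotProduct_sub, dotProduct_add, dotProduct_smul, smul_eq_mul, hz, dot_cross_self,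
      dotProduct_comm z x, hxz, hzy]
    field_simp
    ring
  · change (y ⨯₃ z) ⬝ᵥ _ = 0
    simp only [dotProduct_sub, dotProduct_add, dotProduct_smul, smul_eq_mul, hcc,
      dotProduct_comm (y ⨯₃ z) y, dotProduct_comm (y ⨯₃ z) z, dotProduct_comm (y ⨯₃ z) x,
      dot_cross_self, dot_self_cross]
    field_simp
    ring

/-- Near `y`, the unit vectors making the angle `α` with a moving vector and with a fixed `z`
can be chosen continuously. -/
theorem exists_continuousAt_equidistant (x y z : Fin 3 → ℝ) (k : ℝ)
    (hx : x ⬝ᵥ x = 1) (hy : y ⬝ᵥ y = 1) (hz : z ⬝ᵥ z = 1)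
    (hxy : x ⬝ᵥ y = k) (hxz : x ⬝ᵥ z = k) (hT : x ⬝ᵥ y ⨯₃ z ≠ 0) :
    ∃ X : (Fin 3 → ℝ) → Fin 3 → ℝ, ContinuousAt X y ∧ X y = x ∧
      ∀ᶠ v in nhds y, v ⬝ᵥ v = 1 → X v ⬝ᵥ X v = 1 ∧ X v ⬝ᵥ v = k ∧ X v ⬝ᵥ z = k := by
  have hcc : ∀ v : Fin 3 → ℝ, v ⬝ᵥ v = 1 → (v ⨯₃ z) ⬝ᵥ (v ⨯₃ z) = 1 - (v ⬝ᵥ z) ^ 2 := by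
    intro v hv
    rw [cross_dot_cross, hv, hz, dotProduct_comm z v]; ring
  have hc : 0 < 1 - (y ⬝ᵥ z) ^ 2 := by
    rw [← hcc y hy]
    have hnonneg : 0 ≤ (y ⨯₃ z) ⬝ᵥ (y ⨯₃ z) := by
      rw [Matrix.vec3_dotProduct]
      exact add_nonneg (add_nonneg (mul_self_nonneg _) (mul_self_nonneg _)) (mul_self_nonneg _)
    refine lt_of_le_of_ne hnonneg fun h => hT ?_
    rw [dotProduct_self_eq_zero.1 h.symm, dotProduct_zero]
  have hc1 : 1 + y ⬝ᵥ z ≠ 0 := fun h => hc.ne' (by linear_combination (1 - y ⬝ᵥ z) * h)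
  set T := x ⬝ᵥ y ⨯₃ z with hTdef
  have hxeq := eq_combination_of_dotProduct x y z k hy hz hxy hxz hc.ne'
  rw [← hTdef] at hxeq
  set D : (Fin 3 → ℝ) → ℝ := fun v =>
    (1 - 2 * k ^ 2 / (1 + v ⬝ᵥ z)) / (1 - (v ⬝ᵥ z) ^ 2) with hD
  have hDy : D y = (T / (1 - (y ⬝ᵥ z) ^ 2)) ^ 2 := by
    have h1 := congrArg (fun u => x ⬝ᵥ u) hxeq
    simp only [hx, dotProduct_add, dotProduct_smul, smul_eq_mul, hxy, hxz, ← hTdef] at h1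
    simp only [hD]
    field_simp
    field_simp at h1
    linear_combination h1
  obtain ⟨σ, hσ, hσT⟩ : ∃ σ : ℝ, σ ^ 2 = 1 ∧ σ * √(D y) = T / (1 - (y ⬝ᵥ z) ^ 2) := by
    rw [hDy, Real.sqrt_sq_eq_abs]
    rcases abs_choice (T / (1 - (y ⬝ᵥ z) ^ 2)) with h | h
    · exact ⟨1, by norm_num, by rw [h, one_mul]⟩
    · exact ⟨-1, by norm_num, by rw [h]; ring⟩
  have hdc : Continuous fun v : Fin 3 → ℝ => v ⬝ᵥ z := continuous_id.dotProduct continuous_const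
  have hDc : ContinuousAt D y := by
    simp only [hD]
    refine ContinuousAt.div ?_ (by fun_prop) hc.ne'
    exact continuousAt_const.sub (ContinuousAt.div continuousAt_const (by fun_prop) hc1)
  refine ⟨fun v => (k / (1 + v ⬝ᵥ z)) • (v + z) + (σ * √(D v)) • (v ⨯₃ z), ?_, ?_, ?_⟩
  · have h1 : ContinuousAt (fun v : Fin 3 → ℝ => k / (1 + v ⬝ᵥ z)) y :=
      ContinuousAt.div continuousAt_const (by fun_prop) hc1
    have h2 : ContinuousAt (fun v => σ * √(D v)) y := continuousAt_const.mul hDc.sqrt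
    have h3 : Continuous fun v => v ⨯₃ z := continuous_cross continuous_id continuous_const
    fun_prop
  · simp only [hσT]
    exact hxeq.symm
  · have hDpos : 0 < D y := by
      rw [hDy]
      have := div_ne_zero hT hc.ne'
      positivity
    have hc' : ContinuousAt (fun v : Fin 3 → ℝ => 1 - (v ⬝ᵥ z) ^ 2) y := by fun_prop
    filter_upwards [hDc.eventually (lt_mem_nhds hDpos), hc'.eventually (lt_mem_nhds hc)]
      with v hDv hcv hv
    have hc2 : 1 + v ⬝ᵥ z ≠ 0 := fun h => hcv.ne' (by linear_combination (1 - v ⬝ᵥ z) * h)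
    have hzv : z ⬝ᵥ v = v ⬝ᵥ z := dotProduct_comm z v
    refine ⟨?_, ?_, ?_⟩
    · have hs : √(D v) ^ 2 * (1 - (v ⬝ᵥ z) ^ 2) = 1 - 2 * k ^ 2 / (1 + v ⬝ᵥ z) := by
        rw [Real.sq_sqrt hDv.le]
        simp only [hD]
        field_simp
      simp only [dotProduct_add, add_dotProduct, dotProduct_smul, smul_dotProduct, smul_eq_mul,
        hv, hz, hzv, hcc v hv, dotProduct_comm (v ⨯₃ z) v, dotProduct_comm (v ⨯₃ z) z,
        dot_self_cross, dot_cross_self]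
      have h2 : k / (1 + v ⬝ᵥ z) * (k / (1 + v ⬝ᵥ z) * (1 + v ⬝ᵥ z + (v ⬝ᵥ z + 1))) =
          2 * k ^ 2 / (1 + v ⬝ᵥ z) := by
        field_simp
        ring
      linear_combination h2 + σ ^ 2 * hs + (1 - 2 * k ^ 2 / (1 + v ⬝ᵥ z)) * hσ
    · simp only [add_dotProduct, smul_dotProduct, smul_eq_mul, hv, hzv,
        dotProduct_comm (v ⨯₃ z) v, dot_self_cross]
      field_simp
      ring
    · simp only [add_dotProduct, smul_dotProduct, smul_eq_mul, hz,
        dotProduct_comm (v ⨯₃ z) z, dot_cross_self]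
      field_simp
      ring

/-- A unit vector `y` of a circle with normal `w` can be joined through `x` to a third vector `z`,
each step being the turn by `α` in a circle with normal in a given neighbourhood of `w`. -/
theorem exists_chain (U : Set (Fin 3 → ℝ)) (hU : IsOpen U) (α : ℝ) (hα : Real.sin α ≠ 0)
    (w y : Fin 3 → ℝ) (hwU : w ∈ U) (hw : w ⬝ᵥ w = 1) (hy : y ⬝ᵥ y = 1) (hwy : w ⬝ᵥ y = 0) :
    ∃ x z : Fin 3 → ℝ, ∃ W ∈ U, x ⬝ᵥ x = 1 ∧ z ⬝ᵥ z = 1 ∧ x ⬝ᵥ y = Real.cos α ∧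
      x ⬝ᵥ z = Real.cos α ∧ x ⨯₃ y = Real.sin α • w ∧ x ⨯₃ z = Real.sin α • W ∧
      x ⬝ᵥ y ⨯₃ z ≠ 0 := by
  have hsc := Real.sin_sq_add_cos_sq α
  set n := w ⨯₃ y with hn
  have hnn : n ⬝ᵥ n = 1 := by rw [hn, cross_dot_cross, hw, hy, hwy, dotProduct_comm y w, hwy]; ring
  have hyn : y ⬝ᵥ n = 0 := dot_cross_self w y
  have hwn : w ⬝ᵥ n = 0 := dot_self_cross w y
  have hny : n ⬝ᵥ y = 0 := by rw [dotProduct_comm, hyn]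
  have hyw : y ⬝ᵥ w = 0 := by rw [dotProduct_comm, hwy]
  have hnw : n ⬝ᵥ w = 0 := by rw [dotProduct_comm, hwn]
  have cny : n ⨯₃ y = -w := by
    rw [hn, cross_cross_eq_smul_sub_smul, hwy, hy]; simp
  have cwn : w ⨯₃ n = -y := by
    rw [← cross_anticomm, hn, cross_cross_eq_smul_sub_smul, hw, dotProduct_comm y w, hwy]; simp
  have cwy : w ⨯₃ y = n := rfl
  have cyn : y ⨯₃ n = w := by rw [← cross_anticomm, cny, neg_neg]
  have cnw : n ⨯₃ w = y := by rw [← cross_anticomm, cwn, neg_neg]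
  have cyw : y ⨯₃ w = -n := by rw [← cross_anticomm]
  set x := Real.cos α • y - Real.sin α • n with hx
  set m := Real.sin α • y + Real.cos α • n with hm
  have hxx : x ⬝ᵥ x = 1 := by
    simp only [hx, dotProduct_sub, sub_dotProduct, dotProduct_smul, smul_dotProduct, smul_eq_mul,
      hy, hyn, hny, hnn]
    linear_combination hsc
  have hmm : m ⬝ᵥ m = 1 := by
    simp only [hm, dotProduct_add, add_dotProduct, dotProduct_smul, smul_dotProduct, smul_eq_mul,
      hy, hyn, hny, hnn]
    linear_combination hsc
  have hxy : x ⬝ᵥ y = Real.cos α := by simp [hx, sub_dotProduct, hy, hny]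
  have hwx : w ⬝ᵥ x = 0 := by simp [hx, dotProduct_sub, hwy, hwn]
  have hwm : w ⬝ᵥ m = 0 := by simp [hm, dotProduct_add, hwy, hwn]
  have hmw : m ⬝ᵥ w = 0 := by rw [dotProduct_comm, hwm]
  have hmx : m ⬝ᵥ x = 0 := by
    simp only [hm, hx, dotProduct_sub, add_dotProduct, dotProduct_smul, smul_dotProduct,
      smul_eq_mul, hy, hyn, hny, hnn]
    ring
  have cwx : w ⨯₃ x = m := by
    simp only [hx, hm, map_sub, map_smul, cwy, cwn]
    module
  have cmx : m ⨯₃ x = -w := by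
    rw [← cwx, cross_cross_eq_smul_sub_smul, hwx, hxx]
    simp
  have cxy : x ⨯₃ y = Real.sin α • w := by
    simp only [hx, LinearMap.map_sub₂, LinearMap.map_smul₂, cross_self, cny]
    module
  have hW : ∀ᶠ p : ℝ in nhdsWithin 0 {0}ᶜ, Real.cos p • w + Real.sin p • m ∈ U := by
    refine Filter.Eventually.filter_mono nhdsWithin_le_nhds ?_
    have hc : Continuous fun p : ℝ => Real.cos p • w + Real.sin p • m := by fun_prop
    exact hc.continuousAt.eventually (hU.mem_nhds (by simpa using hwU))
  have hsin : ∀ᶠ p : ℝ in nhdsWithin 0 {0}ᶜ, Real.sin p ≠ 0 := by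
    have := Filter.Eventually.filter_mono (nhdsWithin_le_nhds (s := {0}ᶜ))
      (Ioo_mem_nhds (neg_lt_zero.2 Real.pi_pos) Real.pi_pos)
    filter_upwards [this, self_mem_nhdsWithin] with p hp hp0 h0
    exact hp0 ((Real.sin_eq_zero_iff_of_lt_of_lt hp.1 hp.2).1 h0)
  obtain ⟨p, hpU, hp⟩ := (hW.and hsin).exists
  set W := Real.cos p • w + Real.sin p • m with hWdef
  have hscp := Real.sin_sq_add_cos_sq p
  have hWW : W ⬝ᵥ W = 1 := by
    simp only [hWdef, dotProduct_add, add_dotProduct, dotProduct_smul, smul_dotProduct,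
      smul_eq_mul, hw, hmm, hwm, hmw]
    linear_combination hscp
  have hWx : W ⬝ᵥ x = 0 := by
    simp [hWdef, add_dotProduct, hwx, hmx]
  have cWx : W ⨯₃ x = Real.cos p • m - Real.sin p • w := by
    simp only [hWdef, LinearMap.map_add₂, LinearMap.map_smul₂, cwx, cmx]
    module
  set z := Real.cos α • x + Real.sin α • (W ⨯₃ x) with hz
  have hxz : x ⬝ᵥ z = Real.cos α := by
    simp [hz, dotProduct_add, hxx, dot_cross_self]
  have hzz : z ⬝ᵥ z = 1 := by
    have e1 : (W ⨯₃ x) ⬝ᵥ (W ⨯₃ x) = 1 := by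
      rw [cross_dot_cross, hWW, hxx, hWx]; ring
    simp only [hz, dotProduct_add, add_dotProduct, dotProduct_smul, smul_dotProduct, smul_eq_mul,
      hxx, e1, dotProduct_comm (W ⨯₃ x) x, dot_cross_self]
    linear_combination hsc
  have cxz : x ⨯₃ z = Real.sin α • W := by
    rw [hz, map_add, map_smul, map_smul, cross_self, cross_cross_eq_smul_sub_smul', hxx, hWx]
    simp
  have hT : x ⬝ᵥ y ⨯₃ z ≠ 0 := by
    have : x ⬝ᵥ y ⨯₃ z = -(Real.sin α ^ 2 * Real.sin p) := by
      rw [triple_product_permutation, triple_product_permutation, cxy, hz, cWx]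
      simp only [sub_dotProduct, add_dotProduct, dotProduct_smul, smul_dotProduct,
        smul_eq_mul, dotProduct_comm x w, hwx, hmw, hw]
      ring
    rw [this]
    exact neg_ne_zero.2 (mul_ne_zero (pow_ne_zero 2 hα) hp)
  exact ⟨x, z, W, hpU, hxx, hzz, hxy, hxz, cxy, cxz, hT⟩

/-- If `F` on the circle orthogonal to `w` is `G` turned by the fixed angle `α ∉ πℤ`, for all `w`
in an open set, then `F` is locally constant on the union of these circles. -/
theorem eventually_eq_of_fixed_angle (F G : (Fin 3 → ℝ) → ℝ) (U : Set (Fin 3 → ℝ)) (hU : IsOpen U)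
    (α : ℝ) (hα : Real.sin α ≠ 0)
    (h : ∀ w ∈ U, w ⬝ᵥ w = 1 → ∀ x, x ⬝ᵥ x = 1 → w ⬝ᵥ x = 0 →
      F (Real.cos α • x + Real.sin α • (w ⨯₃ x)) = G x)
    (w y : Fin 3 → ℝ) (hwU : w ∈ U) (hw : w ⬝ᵥ w = 1) (hy : y ⬝ᵥ y = 1) (hwy : w ⬝ᵥ y = 0) :
    ∀ᶠ v in nhds y, v ⬝ᵥ v = 1 → F v = F y := by
  have hsc := Real.sin_sq_add_cos_sq α
  have core : ∀ x v : Fin 3 → ℝ, x ⬝ᵥ x = 1 → v ⬝ᵥ v = 1 → x ⬝ᵥ v = Real.cos α →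
      (Real.sin α)⁻¹ • (x ⨯₃ v) ∈ U → F v = G x := by
    intro x v hx hv hxv hxvU
    rw [← h _ hxvU ?_ x hx ?_]
    · rw [LinearMap.map_smul₂, smul_smul, mul_inv_cancel₀ hα, one_smul,
        cross_cross_eq_smul_sub_smul, hx, dotProduct_comm v x, hxv]
      simp
    · rw [smul_dotProduct, dotProduct_smul, cross_dot_cross, hx, hv, hxv, dotProduct_comm v x, hxv]
      simp only [smul_eq_mul]
      field_simp
      linear_combination -hsc
    · rw [smul_dotProduct, dotProduct_comm, dot_self_cross, smul_zero]
  obtain ⟨x, z, W, hWU, hxx, hzz, hxy, hxz, cxy, cxz, hT⟩ :=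
    exists_chain U hU α hα w y hwU hw hy hwy
  obtain ⟨X, hXc, hXy, hX⟩ := exists_continuousAt_equidistant x y z _ hxx hy hzz hxy hxz hT
  have hFz : F z = G x := core x z hxx hzz hxz (by rwa [cxz, inv_smul_smul₀ hα])
  have hFy : F y = G x := core x y hxx hy hxy (by rwa [cxy, inv_smul_smul₀ hα])
  have c1 : ContinuousAt (fun v => (Real.sin α)⁻¹ • (X v ⨯₃ v)) y :=
    (continuousAt_cross hXc continuousAt_id).const_smul (Real.sin α)⁻¹
  have c2 : ContinuousAt (fun v => (Real.sin α)⁻¹ • (X v ⨯₃ z)) y :=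
    (continuousAt_cross hXc continuousAt_const).const_smul (Real.sin α)⁻¹
  have t1 : ∀ᶠ v in nhds y, (Real.sin α)⁻¹ • (X v ⨯₃ v) ∈ U := by
    refine c1.eventually (hU.mem_nhds ?_)
    beta_reduce
    rwa [hXy, cxy, inv_smul_smul₀ hα]
  have t2 : ∀ᶠ v in nhds y, (Real.sin α)⁻¹ • (X v ⨯₃ z) ∈ U := by
    refine c2.eventually (hU.mem_nhds ?_)
    beta_reduce
    rwa [hXy, cxz, inv_smul_smul₀ hα]
  filter_upwards [hX, t1, t2] with v hv h1 h2 hvv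
  obtain ⟨ha, hb, hc⟩ := hv hvv
  rw [core (X v) v ha hvv hb h1, ← core (X v) z ha hzz hc h2, hFz, hFy]

theorem dotProduct_circle_self {u v : Fin 3 → ℝ} (hu : u ⬝ᵥ u = 1) (hv : v ⬝ᵥ v = 1)
    (huv : u ⬝ᵥ v = 0) (τ : ℝ) :
    (Real.cos τ • u + Real.sin τ • v) ⬝ᵥ (Real.cos τ • u + Real.sin τ • v) = 1 := by
  have hvu : v ⬝ᵥ u = 0 := by rw [dotProduct_comm, huv]
  simp only [dotProduct_add, add_dotProduct, dotProduct_smul, smul_dotProduct, smul_eq_mul,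
    hu, hv, huv, hvu]
  linear_combination Real.sin_sq_add_cos_sq τ

theorem eq_zero_of_fixed_angle (F G : (Fin 3 → ℝ) → ℝ) (U : Set (Fin 3 → ℝ)) (hU : IsOpen U)
    (α : ℝ) (hα : Real.sin α ≠ 0) (hodd : ∀ x, x ⬝ᵥ x = 1 → F (-x) = -F x)
    (h : ∀ w ∈ U, w ⬝ᵥ w = 1 → ∀ x, x ⬝ᵥ x = 1 → w ⬝ᵥ x = 0 →
      F (Real.cos α • x + Real.sin α • (w ⨯₃ x)) = G x)
    (w y : Fin 3 → ℝ) (hwU : w ∈ U) (hw : w ⬝ᵥ w = 1) (hy : y ⬝ᵥ y = 1) (hwy : w ⬝ᵥ y = 0) :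
    F y = 0 := by
  have hnn : (w ⨯₃ y) ⬝ᵥ (w ⨯₃ y) = 1 := by
    rw [cross_dot_cross, hw, hy, hwy, dotProduct_comm y w, hwy]; ring
  set c : ℝ → Fin 3 → ℝ := fun τ => Real.cos τ • y + Real.sin τ • (w ⨯₃ y) with hc
  have hcc : Continuous c := by fun_prop
  have hc1 : ∀ τ, c τ ⬝ᵥ c τ = 1 := dotProduct_circle_self hy hnn (dot_cross_self w y)
  have hcw : ∀ τ, w ⬝ᵥ c τ = 0 := fun τ => by
    simp [hc, dotProduct_add, hwy, dot_self_cross]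
  have hloc : IsLocallyConstant fun τ => F (c τ) := by
    rw [IsLocallyConstant.iff_eventually_eq]
    intro τ
    have := hcc.continuousAt.eventually
      (eventually_eq_of_fixed_angle F G U hU α hα h w (c τ) hwU hw (hc1 τ) (hcw τ))
    filter_upwards [this] with t ht using ht (hc1 t)
  have h1 := hloc.apply_eq_of_preconnectedSpace 0 Real.pi
  simp only [hc, Real.cos_zero, Real.sin_zero, Real.cos_pi, Real.sin_pi, one_smul, zero_smul,
    add_zero, neg_smul, hodd y hy] at h1
  linarith

/-- The vector `r`, turned by the angle `τ` about `w`. -/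
def circ (w r : Fin 3 → ℝ) (τ : ℝ) : Fin 3 → ℝ := Real.cos τ • r + Real.sin τ • (w ⨯₃ r)

theorem cross_dotProduct_self {w r : Fin 3 → ℝ} (hw : w ⬝ᵥ w = 1) (hr : r ⬝ᵥ r = 1)
    (hwr : w ⬝ᵥ r = 0) : (w ⨯₃ r) ⬝ᵥ (w ⨯₃ r) = 1 := by
  rw [cross_dot_cross, hw, hr, hwr, dotProduct_comm r w, hwr]; ring

theorem circ_dotProduct_self {w r : Fin 3 → ℝ} (hw : w ⬝ᵥ w = 1) (hr : r ⬝ᵥ r = 1)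
    (hwr : w ⬝ᵥ r = 0) (τ : ℝ) : circ w r τ ⬝ᵥ circ w r τ = 1 :=
  dotProduct_circle_self hr (cross_dotProduct_self hw hr hwr) (dot_cross_self w r) τ

theorem dotProduct_circ {w r : Fin 3 → ℝ} (hwr : w ⬝ᵥ r = 0) (τ : ℝ) : w ⬝ᵥ circ w r τ = 0 := by
  simp [circ, dotProduct_add, hwr, dot_self_cross]

theorem circ_zero (w r : Fin 3 → ℝ) : circ w r 0 = r := by simp [circ]

theorem circ_add_pi (w r : Fin 3 → ℝ) (τ : ℝ) : circ w r (τ + Real.pi) = -circ w r τ := by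
  simp only [circ, Real.cos_add_pi, Real.sin_add_pi]
  module

theorem circ_add_two_pi (w r : Fin 3 → ℝ) (τ : ℝ) :
    circ w r (τ + 2 * Real.pi) = circ w r τ := by
  simp only [circ, Real.cos_add_two_pi, Real.sin_add_two_pi]

theorem circ_circ {w r : Fin 3 → ℝ} (hw : w ⬝ᵥ w = 1) (hwr : w ⬝ᵥ r = 0) (β τ : ℝ) :
    circ w (circ w r β) τ = circ w r (τ + β) := by
  have h : w ⨯₃ (w ⨯₃ r) = -r := by
    rw [cross_cross_eq_smul_sub_smul', hw, hwr]; simp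
  simp only [circ, map_add, map_smul, h, Real.cos_add, Real.sin_add]
  module

theorem exists_eq_circ {w r x : Fin 3 → ℝ} (hw : w ⬝ᵥ w = 1) (hr : r ⬝ᵥ r = 1)
    (hwr : w ⬝ᵥ r = 0) (hx : x ⬝ᵥ x = 1) (hwx : w ⬝ᵥ x = 0) : ∃ β, x = circ w r β := by
  have hnn := cross_dotProduct_self hw hr hwr
  set n := w ⨯₃ r with hn
  have e1 : x = (x ⬝ᵥ r) • r + (x ⬝ᵥ n) • n := by
    have h1 : n ⨯₃ (x ⨯₃ n) = x - (x ⬝ᵥ n) • n := by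
      rw [cross_cross_eq_smul_sub_smul', hnn, one_smul]
    have h2 : x ⨯₃ n = (x ⬝ᵥ r) • w := by
      rw [hn, cross_cross_eq_smul_sub_smul', hwx]; simp
    have h3 : n ⨯₃ w = r := by
      rw [hn, cross_cross_eq_smul_sub_smul, hw, dotProduct_comm r w, hwr]; simp
    rw [h2, map_smul, h3] at h1
    rw [h1]
    module
  have hxx : (x ⬝ᵥ r) ^ 2 + (x ⬝ᵥ n) ^ 2 = 1 := by
    have := congrArg (fun y => x ⬝ᵥ y) e1
    simp only [dotProduct_add, dotProduct_smul, smul_eq_mul, hx] at this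
    linarith
  obtain ⟨δ, h1, h2⟩ := exists_polar (x ⬝ᵥ r) (x ⬝ᵥ n)
  rw [hxx, Real.sqrt_one, one_mul] at h1 h2
  refine ⟨δ, ?_⟩
  rw [circ, ← h1, ← h2]
  exact e1

theorem continuous_circ : Continuous fun q : ((Fin 3 → ℝ) × (Fin 3 → ℝ)) × ℝ =>
    circ q.1.1 q.1.2 q.2 := by
  have := continuous_cross (u := fun q : ((Fin 3 → ℝ) × (Fin 3 → ℝ)) × ℝ => q.1.1)
    (v := fun q => q.1.2) (by fun_prop) (by fun_prop)
  simp only [circ]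
  fun_prop

theorem mem_Icc_of_dotProduct_self {x : Fin 3 → ℝ} (hx : x ⬝ᵥ x = 1) :
    x ∈ Icc (-1 : Fin 3 → ℝ) 1 := by
  rw [Matrix.vec3_dotProduct] at hx
  have h : ∀ i, |x i| ≤ 1 := by
    intro i
    refine abs_le_one_iff_mul_self_le_one.2 ?_
    fin_cases i <;> simp <;>
      nlinarith [mul_self_nonneg (x 0), mul_self_nonneg (x 1), mul_self_nonneg (x 2)]
  exact ⟨fun i => (abs_le.1 (h i)).1, fun i => (abs_le.1 (h i)).2⟩

theorem isCompact_unit_vectors : IsCompact {w : Fin 3 → ℝ | w ⬝ᵥ w = 1} :=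
  isCompact_Icc.of_isClosed_subset
    (isClosed_eq (continuous_id.dotProduct continuous_id) continuous_const)
    fun _ => mem_Icc_of_dotProduct_self

/-- The unit vectors admitting an orthogonal unit vector that satisfies a closed condition form
a closed set. -/
theorem isClosed_setOf_exists_frame (C : Set ((Fin 3 → ℝ) × (Fin 3 → ℝ))) (hC : IsClosed C) :
    IsClosed {w : Fin 3 → ℝ | w ⬝ᵥ w = 1 ∧ ∃ r, r ⬝ᵥ r = 1 ∧ w ⬝ᵥ r = 0 ∧ (w, r) ∈ C} := by
  set S := {q : (Fin 3 → ℝ) × (Fin 3 → ℝ) | q.1 ⬝ᵥ q.1 = 1 ∧ q.2 ⬝ᵥ q.2 = 1 ∧ q.1 ⬝ᵥ q.2 = 0 ∧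
    q ∈ C} with hS
  have hSc : IsCompact S := by
    refine (isCompact_unit_vectors.prod isCompact_unit_vectors).of_isClosed_subset ?_
      fun q hq => ⟨hq.1, hq.2.1⟩
    refine (isClosed_eq (continuous_fst.dotProduct continuous_fst) continuous_const).inter
      ((isClosed_eq (continuous_snd.dotProduct continuous_snd) continuous_const).inter
      ((isClosed_eq (continuous_fst.dotProduct continuous_snd) continuous_const).inter hC))
  convert (hSc.image continuous_fst).isClosed using 1
  ext w
  constructor
  · rintro ⟨hw, r, hr, hwr, hC⟩
    exact ⟨(w, r), ⟨hw, hr, hwr, hC⟩, rfl⟩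
  · rintro ⟨⟨w', r⟩, ⟨hw, hr, hwr, hC⟩, rfl⟩
    exact ⟨hw, r, hr, hwr, hC⟩

/-- The unit vectors `w` for which each `G s`, on the circle orthogonal to `w`, is `F s` turned by
the angle `α`. -/
def rotSet (F G : ℝ → (Fin 3 → ℝ) → ℝ) (α : ℝ) : Set (Fin 3 → ℝ) :=
  {w | w ⬝ᵥ w = 1 ∧ ∃ r, r ⬝ᵥ r = 1 ∧ w ⬝ᵥ r = 0 ∧
    (w, r) ∈ {q : (Fin 3 → ℝ) × (Fin 3 → ℝ) |
      ∀ s τ, F s (circ q.1 q.2 (τ + α)) = G s (circ q.1 q.2 τ)}}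

/-- The unit vectors `w` for which each `G s`, on the circle orthogonal to `w`, is the reflection
of `F (π - s)` in a common line. -/
def reflSet (F G : ℝ → (Fin 3 → ℝ) → ℝ) : Set (Fin 3 → ℝ) :=
  {w | w ⬝ᵥ w = 1 ∧ ∃ r, r ⬝ᵥ r = 1 ∧ w ⬝ᵥ r = 0 ∧
    (w, r) ∈ {q : (Fin 3 → ℝ) × (Fin 3 → ℝ) |
      ∀ s τ, F (Real.pi - s) (circ q.1 q.2 (-τ)) = G s (circ q.1 q.2 τ)}}

theorem mem_rotSet_iff {F G : ℝ → (Fin 3 → ℝ) → ℝ} {α : ℝ} {w : Fin 3 → ℝ} :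
    w ∈ rotSet F G α ↔ w ⬝ᵥ w = 1 ∧ ∀ x, x ⬝ᵥ x = 1 → w ⬝ᵥ x = 0 →
      ∀ s, F s (circ w x α) = G s x := by
  constructor
  · rintro ⟨hw, r, hr, hwr, h⟩
    refine ⟨hw, fun x hx hwx s => ?_⟩
    obtain ⟨β, rfl⟩ := exists_eq_circ hw hr hwr hx hwx
    rw [circ_circ hw hwr, add_comm]
    exact h s β
  · rintro ⟨hw, h⟩
    obtain ⟨r, hr, hwr⟩ := exists_unit_orthogonal w
    refine ⟨hw, r, hr, hwr, fun s τ => ?_⟩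
    have := h _ (circ_dotProduct_self hw hr hwr τ) (dotProduct_circ hwr τ) s
    rwa [circ_circ hw hwr, add_comm] at this

theorem isClosed_rotSet {F G : ℝ → (Fin 3 → ℝ) → ℝ}
    (hF : Continuous fun q : ℝ × (Fin 3 → ℝ) => F q.1 q.2)
    (hG : Continuous fun q : ℝ × (Fin 3 → ℝ) => G q.1 q.2)
    (α : ℝ) : IsClosed (rotSet F G α) := by
  refine isClosed_setOf_exists_frame _ ?_
  simp only [ofPred_forall]
  refine isClosed_iInter fun s => isClosed_iInter fun τ => isClosed_eq ?_ ?_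
  · exact hF.comp (continuous_const.prodMk (continuous_circ.comp (by fun_prop :
      Continuous fun q : (Fin 3 → ℝ) × (Fin 3 → ℝ) => (q, τ + α))))
  · exact hG.comp (continuous_const.prodMk (continuous_circ.comp (by fun_prop :
      Continuous fun q : (Fin 3 → ℝ) × (Fin 3 → ℝ) => (q, τ))))

theorem isClosed_reflSet {F G : ℝ → (Fin 3 → ℝ) → ℝ}
    (hF : Continuous fun q : ℝ × (Fin 3 → ℝ) => F q.1 q.2)
    (hG : Continuous fun q : ℝ × (Fin 3 → ℝ) => G q.1 q.2) : IsClosed (reflSet F G) := by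
  refine isClosed_setOf_exists_frame _ ?_
  simp only [ofPred_forall]
  refine isClosed_iInter fun s => isClosed_iInter fun τ => isClosed_eq ?_ ?_
  · exact hF.comp (continuous_const.prodMk (continuous_circ.comp (by fun_prop :
      Continuous fun q : (Fin 3 → ℝ) × (Fin 3 → ℝ) => (q, -τ))))
  · exact hG.comp (continuous_const.prodMk (continuous_circ.comp (by fun_prop :
      Continuous fun q : (Fin 3 → ℝ) × (Fin 3 → ℝ) => (q, τ))))

theorem mem_reflSet_of_angle {F G : ℝ → (Fin 3 → ℝ) → ℝ} {w r : Fin 3 → ℝ} (hw : w ⬝ᵥ w = 1)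
    (hr : r ⬝ᵥ r = 1) (hwr : w ⬝ᵥ r = 0) (β : ℝ)
    (h : ∀ s τ, F (Real.pi - s) (circ w r (β - τ)) = G s (circ w r τ)) : w ∈ reflSet F G := by
  refine ⟨hw, circ w r (β / 2), circ_dotProduct_self hw hr hwr _, dotProduct_circ hwr _,
    fun s τ => ?_⟩
  simp only [circ_circ hw hwr]
  rw [← h s (τ + β / 2)]
  congr 2
  ring

/-- A continuous function with `P (τ + π) = -P τ` whose square is invariant under an irrational
rotation vanishes. -/
theorem eq_zero_of_irrational_rotation (P : ℝ → ℝ) (hP : Continuous P) (α : ℝ)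
    (hα : Irrational (α / Real.pi)) (hπ : ∀ τ, P (τ + Real.pi) = -P τ)
    (h : ∀ τ, P (τ + α) ^ 2 = P τ ^ 2) (τ : ℝ) : P τ = 0 := by
  have hd := dense_addSubgroupClosure_pair_iff.2 hα
  have hinv : ∀ t ∈ AddSubgroup.closure {α, Real.pi}, ∀ τ, P (τ + t) ^ 2 = P τ ^ 2 := by
    intro t ht
    induction ht using AddSubgroup.closure_induction with
    | mem x hx =>
      rcases hx with rfl | hx
      · exact h
      · intro τ
        rw [mem_singleton_iff.1 hx, hπ, neg_sq]
    | zero => simp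
    | add x y _ _ hx hy =>
      intro τ
      rw [← add_assoc, hy, hx]
    | neg x _ hx =>
      intro τ
      rw [← hx (τ + -x), neg_add_cancel_right]
  have hconst : ∀ t τ, P (τ + t) ^ 2 = P τ ^ 2 := by
    intro t τ
    have hcl : IsClosed {t | P (τ + t) ^ 2 = P τ ^ 2} := isClosed_eq (by fun_prop) (by fun_prop)
    exact hcl.closure_subset_iff.2 (fun t ht => hinv t ht τ) (hd t)
  obtain ⟨t, ht⟩ : ∃ t, P t = 0 := by
    have hm : (0 : ℝ) ∈ uIcc (P 0) (P Real.pi) := by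
      have h0 : P Real.pi = -P 0 := by simpa using hπ 0
      rw [h0, mem_uIcc]
      rcases le_total (P 0) 0 with h | h
      · exact Or.inl ⟨h, by linarith⟩
      · exact Or.inr ⟨by linarith, h⟩
    obtain ⟨t, -, ht⟩ := intermediate_value_uIcc hP.continuousOn hm
    exact ⟨t, ht⟩
  have := hconst (τ - t) t
  rw [ht, add_sub_cancel] at this
  simpa using this

/-- The circle orthogonal to `w` starting at `r`: on it, the family `G s` is either `F s` turned by
some angle, or `F (π - s)` reflected in some line. -/
def RotOrRefl (F G : ℝ → (Fin 3 → ℝ) → ℝ) (w r : Fin 3 → ℝ) : Prop :=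
  (∃ α, ∀ s τ, F s (circ w r (τ + α)) = G s (circ w r τ)) ∨
    ∃ β, ∀ s τ, F (Real.pi - s) (circ w r (β - τ)) = G s (circ w r τ)

theorem continuous_circ_right (w r : Fin 3 → ℝ) : Continuous (circ w r) :=
  (continuous_circ.comp (Continuous.prodMk_right (w, r)) :)

theorem periodic_circ (w r : Fin 3 → ℝ) : Function.Periodic (circ w r) (2 * Real.pi) :=
  circ_add_two_pi w r

theorem integral_circ_add (w r : Fin 3 → ℝ) (b : (Fin 3 → ℝ) → ℝ) (α : ℝ) :
    ∫ τ in (0 : ℝ)..(2 * Real.pi), b (circ w r (τ + α)) =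
      ∫ τ in (0 : ℝ)..(2 * Real.pi), b (circ w r τ) := by
  rw [intervalIntegral.integral_comp_add_right (fun τ => b (circ w r τ))]
  have := ((periodic_circ w r).comp b).intervalIntegral_add_eq α 0
  simpa [add_comm] using this

theorem integral_circ_sub (w r : Fin 3 → ℝ) (b : (Fin 3 → ℝ) → ℝ) (β : ℝ) :
    ∫ τ in (0 : ℝ)..(2 * Real.pi), b (circ w r (β - τ)) =
      ∫ τ in (0 : ℝ)..(2 * Real.pi), b (circ w r τ) := by
  rw [intervalIntegral.integral_comp_sub_left (fun τ => b (circ w r τ))]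
  have := ((periodic_circ w r).comp b).intervalIntegral_add_eq (β - 2 * Real.pi) 0
  simpa using this

/-- The squares of the parts of `F s` and `G s` that are even or odd under `s ↦ π - s` agree. -/
theorem sq_eq_sq_of_rotOrRefl {F G : ℝ → (Fin 3 → ℝ) → ℝ}
    (hF : Continuous fun q : ℝ × (Fin 3 → ℝ) => F q.1 q.2)
    (hG : Continuous fun q : ℝ × (Fin 3 → ℝ) => G q.1 q.2)
    (hFodd : ∀ s x, x ⬝ᵥ x = 1 → F s (-x) = -F s x)
    (hGodd : ∀ s x, x ⬝ᵥ x = 1 → G s (-x) = -G s x)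
    (h : ∀ w r, w ⬝ᵥ w = 1 → r ⬝ᵥ r = 1 → w ⬝ᵥ r = 0 → RotOrRefl F G w r)
    (ε : ℝ) (hε : ε ^ 2 = 1) (s : ℝ) (p : Fin 3 → ℝ) (hp : p ⬝ᵥ p = 1) :
    (F s p + ε * F (Real.pi - s) p) ^ 2 = (G s p + ε * G (Real.pi - s) p) ^ 2 := by
  have hFs : ∀ s, Continuous (F s) := fun s => hF.comp (by fun_prop : Continuous fun x => (s, x))
  have hGs : ∀ s, Continuous (G s) := fun s => hG.comp (by fun_prop : Continuous fun x => (s, x))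
  have hF1 := hFs s
  have hF2 := hFs (Real.pi - s)
  have hG1 := hGs s
  have hG2 := hGs (Real.pi - s)
  rw [← sub_eq_zero]
  refine eq_zero_of_circle_integrals_eq_zero
    (fun x => (F s x + ε * F (Real.pi - s) x) ^ 2 - (G s x + ε * G (Real.pi - s) x) ^ 2)
    (by fun_prop) (fun x hx => ?_) (fun u v hu hv huv => ?_) p hp
  · simp only [hFodd _ x hx, hGodd _ x hx]
    ring
  set w := u ⨯₃ v with hw
  have hww : w ⬝ᵥ w = 1 := cross_dotProduct_self hu hv huv
  have hwu : w ⬝ᵥ u = 0 := by rw [dotProduct_comm]; exact dot_self_cross u v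
  have hwv : w ⨯₃ u = v := by
    rw [hw, cross_cross_eq_smul_sub_smul, hu, dotProduct_comm v u, huv]; simp
  have hc : ∀ τ, Real.cos τ • u + Real.sin τ • v = circ w u τ := fun τ => by rw [circ, hwv]
  have hcc := continuous_circ_right w u
  simp only [hc]
  rw [intervalIntegral.integral_sub (Continuous.intervalIntegrable (by fun_prop) _ _)
    (Continuous.intervalIntegrable (by fun_prop) _ _), sub_eq_zero]
  rcases h w u hww hu hwu with ⟨α, hα⟩ | ⟨β, hβ⟩
  · rw [← integral_circ_add w u (fun x => (F s x + ε * F (Real.pi - s) x) ^ 2) α]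
    simp only [hα]
  · rw [← integral_circ_sub w u (fun x => (F s x + ε * F (Real.pi - s) x) ^ 2) β]
    have h1 : ∀ τ, F s (circ w u (β - τ)) = G (Real.pi - s) (circ w u τ) := fun τ => by
      rw [← hβ, sub_sub_cancel]
    simp only [hβ, h1]
    congr 1
    ext τ
    linear_combination
      (G s (circ w u τ) ^ 2 - G (Real.pi - s) (circ w u τ) ^ 2) * hε

theorem mem_rotSet_zero_of_eq_zero {F G : ℝ → (Fin 3 → ℝ) → ℝ} {w r : Fin 3 → ℝ} {α : ℝ}
    (hw : w ⬝ᵥ w = 1) (hr : r ⬝ᵥ r = 1) (hwr : w ⬝ᵥ r = 0)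
    (hα : ∀ s τ, F s (circ w r (τ + α)) = G s (circ w r τ))
    (h0 : ∀ s τ, F s (circ w r τ) = 0) : w ∈ rotSet F G 0 :=
  ⟨hw, r, hr, hwr, fun s τ => by simp only [← hα, h0]⟩

/-- Away from the three exceptional families, the angle of rotation is a rational multiple of
`π`. -/
theorem exists_rational_angle {F G : ℝ → (Fin 3 → ℝ) → ℝ}
    (hF : Continuous fun q : ℝ × (Fin 3 → ℝ) => F q.1 q.2)
    (hG : Continuous fun q : ℝ × (Fin 3 → ℝ) => G q.1 q.2)
    (hFodd : ∀ s x, x ⬝ᵥ x = 1 → F s (-x) = -F s x)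
    (hGodd : ∀ s x, x ⬝ᵥ x = 1 → G s (-x) = -G s x)
    (h : ∀ w r, w ⬝ᵥ w = 1 → r ⬝ᵥ r = 1 → w ⬝ᵥ r = 0 → RotOrRefl F G w r)
    (w : Fin 3 → ℝ) (hw : w ⬝ᵥ w = 1) :
    w ∈ rotSet F G 0 ∪ rotSet F G Real.pi ∪ reflSet F G ∨
      ∃ q : ℚ, w ∈ rotSet F G (q * Real.pi) := by
  obtain ⟨r, hr, hwr⟩ := exists_unit_orthogonal w
  rcases h w r hw hr hwr with ⟨α, hα⟩ | ⟨β, hβ⟩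
  swap
  · exact Or.inl (Or.inr (mem_reflSet_of_angle hw hr hwr β hβ))
  by_cases hirr : Irrational (α / Real.pi)
  · refine Or.inl (Or.inl (Or.inl (mem_rotSet_zero_of_eq_zero hw hr hwr hα fun s τ => ?_)))
    have hc := continuous_circ_right w r
    have hc1 := circ_dotProduct_self hw hr hwr
    have key : ∀ ε : ℝ, ε ^ 2 = 1 →
        F s (circ w r τ) + ε * F (Real.pi - s) (circ w r τ) = 0 := by
      intro ε hε
      have hF1 : ∀ s, Continuous fun τ => F s (circ w r τ) := fun s =>
        hF.comp (by fun_prop : Continuous fun τ => (s, circ w r τ))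
      refine eq_zero_of_irrational_rotation
        (fun τ => F s (circ w r τ) + ε * F (Real.pi - s) (circ w r τ))
        ((hF1 s).add (continuous_const.mul (hF1 _))) α hirr (fun t => ?_) (fun t => ?_) τ
      · simp only [circ_add_pi, hFodd _ _ (hc1 t)]
        ring
      · simp only [hα]
        exact (sq_eq_sq_of_rotOrRefl hF hG hFodd hGodd h ε hε s _ (hc1 t)).symm
    have h1 := key 1 (by norm_num)
    have h2 := key (-1) (by norm_num)
    linarith
  · obtain ⟨q, hq⟩ := not_not.1 hirr
    refine Or.inr ⟨q, hw, r, hr, hwr, ?_⟩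
    rw [hq, div_mul_cancel₀ _ Real.pi_ne_zero]
    exact hα

theorem mem_rotSet_of_sin_eq_zero {F G : ℝ → (Fin 3 → ℝ) → ℝ} {α : ℝ} (hα : Real.sin α = 0)
    {w : Fin 3 → ℝ} (h : w ∈ rotSet F G α) : w ∈ rotSet F G 0 ∪ rotSet F G Real.pi := by
  simp only [mem_union, mem_rotSet_iff, circ, hα, zero_smul, add_zero, Real.sin_zero,
    Real.sin_pi, Real.cos_zero, Real.cos_pi] at h ⊢
  have hsq : Real.cos α * Real.cos α = 1 := by
    have := Real.sin_sq_add_cos_sq α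
    rw [hα] at this
    linarith
  rcases mul_self_eq_one_iff.1 hsq with h1 | h1
  · exact Or.inl (h1 ▸ h)
  · exact Or.inr (h1 ▸ h)

theorem mem_rotSet_or_mem_reflSet {F G : ℝ → (Fin 3 → ℝ) → ℝ}
    (hF : Continuous fun q : ℝ × (Fin 3 → ℝ) => F q.1 q.2)
    (hG : Continuous fun q : ℝ × (Fin 3 → ℝ) => G q.1 q.2)
    (hFodd : ∀ s x, x ⬝ᵥ x = 1 → F s (-x) = -F s x)
    (hGodd : ∀ s x, x ⬝ᵥ x = 1 → G s (-x) = -G s x)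
    (h : ∀ w r, w ⬝ᵥ w = 1 → r ⬝ᵥ r = 1 → w ⬝ᵥ r = 0 → RotOrRefl F G w r)
    (w : Fin 3 → ℝ) (hw : w ⬝ᵥ w = 1) :
    w ∈ rotSet F G 0 ∪ rotSet F G Real.pi ∪ reflSet F G := by
  by_contra hwS
  set S := rotSet F G 0 ∪ rotSet F G Real.pi ∪ reflSet F G with hS
  have hSc : IsClosed S := ((isClosed_rotSet hF hG _).union (isClosed_rotSet hF hG _)).union
    (isClosed_reflSet hF hG)
  let X := {w : Fin 3 → ℝ | w ⬝ᵥ w = 1}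
  have : CompactSpace X := isCompact_iff_compactSpace.1 isCompact_unit_vectors
  let K : Option ℚ → Set X := fun o =>
    o.elim (Subtype.val ⁻¹' S) fun q => Subtype.val ⁻¹' rotSet F G (q * Real.pi)
  have hKc : ∀ o, IsClosed (K o) := by
    rintro (_ | q)
    · exact hSc.preimage continuous_subtype_val
    · exact (isClosed_rotSet hF hG _).preimage continuous_subtype_val
  have hKU : ⋃ o, K o = univ := by
    refine eq_univ_of_forall fun x => mem_iUnion.2 ?_
    rcases exists_rational_angle hF hG hFodd hGodd h x.1 x.2 with hx | ⟨q, hx⟩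
    · exact ⟨none, hx⟩
    · exact ⟨some q, hx⟩
  obtain ⟨⟨w₀, hw₀⟩, hwS₀, hwK⟩ := (dense_iUnion_interior_of_closed hKc hKU).inter_open_nonempty
    (K none)ᶜ (hKc none).isOpen_compl ⟨⟨w, hw⟩, hwS⟩
  obtain ⟨o, ho⟩ := mem_iUnion.1 hwK
  rcases o with _ | q
  · exact hwS₀ (interior_subset ho)
  have hq : w₀ ∈ rotSet F G (q * Real.pi) :=
    interior_subset (s := Subtype.val ⁻¹' rotSet F G (q * Real.pi)) ho
  by_cases hsin : Real.sin (q * Real.pi) = 0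
  · exact hwS₀ (Or.inl (mem_rotSet_of_sin_eq_zero hsin hq))
  obtain ⟨U, hU, hUo⟩ := isOpen_induced_iff.1 (isOpen_interior (s := K (some q)))
  have hU' : ∀ v ∈ U, v ⬝ᵥ v = 1 → v ∈ rotSet F G (q * Real.pi) := fun v hv hv1 =>
    interior_subset (s := K (some q)) (hUo ▸ (show (⟨v, hv1⟩ : X) ∈ Subtype.val ⁻¹' U from hv))
  have hzero : ∀ s y, y ⬝ᵥ y = 1 → w₀ ⬝ᵥ y = 0 → F s y = 0 := fun s y hy hwy =>
    eq_zero_of_fixed_angle (F s) (G s) U hU _ hsin (hFodd s)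
      (fun v hv hv1 x hx hvx => (mem_rotSet_iff.1 (hU' v hv hv1)).2 x hx hvx s)
      w₀ y (show (⟨w₀, hw₀⟩ : X) ∈ Subtype.val ⁻¹' U from hUo ▸ ho) hw₀ hy hwy
  obtain ⟨-, r, hr, hwr, hα⟩ := hq
  exact hwS₀ (Or.inl (Or.inl (mem_rotSet_zero_of_eq_zero hw₀ hr hwr hα fun s τ =>
    hzero s _ (circ_dotProduct_self hw₀ hr hwr τ) (dotProduct_circ hwr τ))))

/-- The hyperplane orthogonal to a unit vector of `E4`, identified with `ℝ³`. -/
theorem exists_linearMap_orthogonal (ζ : E4) (hζ : ζ ∈ sph) :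
    ∃ L : (Fin 3 → ℝ) →ₗ[ℝ] E4, (∀ x y, ⟪L x, L y⟫ = x ⬝ᵥ y) ∧ (∀ x, ⟪L x, ζ⟫ = 0) ∧
      ∀ θ, ∃ x, θ = ⟪θ, ζ⟫ • ζ + L x := by
  have hζ1 : ‖ζ‖ = 1 := by simpa [sph] using hζ
  have hv : Orthonormal ℝ (({0} : Set (Fin 4)).domRestrict fun _ => ζ) :=
    ⟨fun _ => hζ1, fun i j hij => (hij (Subsingleton.elim i j)).elim⟩
  obtain ⟨b, hb⟩ := hv.exists_orthonormalBasis_extension_of_card_eq (by simp)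
  have hb0 : b 0 = ζ := hb 0 rfl
  refine ⟨∑ i : Fin 3, (LinearMap.proj i).smulRight (b i.succ), fun x y => ?_, fun x => ?_,
    fun θ => ⟨fun i => ⟪b i.succ, θ⟫, ?_⟩⟩
  · simp [sum_inner, inner_sum, inner_smul_left, inner_smul_right, b.inner_eq_ite, dotProduct,
      Fin.succ_inj, mul_comm]
  · simp [← hb0, sum_inner, inner_smul_left, b.inner_eq_ite]
  · conv_lhs => rw [← b.sum_repr' θ]
    rw [Fin.sum_univ_succ, hb0, real_inner_comm]
    simp

/-- The point of the sphere with polar angle `s` from `ζ` and direction `x`. -/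
def polarPoint (ζ : E4) (L : (Fin 3 → ℝ) →ₗ[ℝ] E4) (s : ℝ) (x : Fin 3 → ℝ) : E4 :=
  Real.cos s • ζ + Real.sin s • L x

section

variable {ζ : E4} {L : (Fin 3 → ℝ) →ₗ[ℝ] E4}

theorem polarPoint_mem_S2 (hζ : ζ ∈ sph) (hL : ∀ x y, ⟪L x, L y⟫ = x ⬝ᵥ y)
    (hLζ : ∀ x, ⟪L x, ζ⟫ = 0) {w x : Fin 3 → ℝ} (hx : x ⬝ᵥ x = 1) (hwx : w ⬝ᵥ x = 0) (s : ℝ) :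
    polarPoint ζ L s x ∈ S2 (L w) := by
  have hζ1 : ‖ζ‖ = 1 := by simpa [sph] using hζ
  have hζL : ∀ x, ⟪ζ, L x⟫ = 0 := fun x => by rw [real_inner_comm, hLζ]
  refine ⟨?_, ?_⟩
  · have : ‖polarPoint ζ L s x‖ ^ 2 = 1 := by
      rw [← real_inner_self_eq_norm_sq]
      simp only [polarPoint, inner_add_left, inner_add_right, inner_smul_left, inner_smul_right,
        hL, hLζ, hζL, hx, real_inner_self_eq_norm_sq, hζ1]
      simp
      linear_combination Real.sin_sq_add_cos_sq s
    rw [sph, mem_sphere_zero_iff_norm]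
    exact (pow_eq_one_iff_of_nonneg (norm_nonneg _) two_ne_zero).1 this
  · simp [polarPoint, inner_add_left, inner_smul_left, hL, hζL, dotProduct_comm x w, hwx]

theorem exists_eq_polarPoint (hζ : ζ ∈ sph) (hL : ∀ x y, ⟪L x, L y⟫ = x ⬝ᵥ y)
    (hLζ : ∀ x, ⟪L x, ζ⟫ = 0) (hθ : ∀ θ, ∃ x, θ = ⟪θ, ζ⟫ • ζ + L x) {w : Fin 3 → ℝ} {θ : E4}
    (h : θ ∈ S2 (L w)) :
    ∃ s x, x ⬝ᵥ x = 1 ∧ w ⬝ᵥ x = 0 ∧ θ = polarPoint ζ L s x := by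
  have hζ1 : ‖ζ‖ = 1 := by simpa [sph] using hζ
  have hθ1 : ‖θ‖ = 1 := by simpa [sph] using h.1
  have hζL : ∀ x, ⟪ζ, L x⟫ = 0 := fun x => by rw [real_inner_comm, hLζ]
  obtain ⟨x, hx⟩ := hθ θ
  set c := ⟪θ, ζ⟫ with hc
  have hcx : c ^ 2 + x ⬝ᵥ x = 1 := by
    have : ⟪θ, θ⟫ = 1 := by rw [real_inner_self_eq_norm_sq, hθ1, one_pow]
    rw [hx] at this
    simp only [inner_add_left, inner_add_right, inner_smul_left, inner_smul_right,
        hL, hLζ, hζL, real_inner_self_eq_norm_sq, hζ1] at this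
    simp at this
    linarith
  have hwx : w ⬝ᵥ x = 0 := by
    have := h.2
    rw [hx, inner_add_left, inner_smul_left, hζL, hL, dotProduct_comm] at this
    simpa using this
  obtain ⟨s, h1, h2⟩ := exists_polar c (√(x ⬝ᵥ x))
  have hnn : 0 ≤ x ⬝ᵥ x := Finset.sum_nonneg fun i _ => mul_self_nonneg (x i)
  rw [Real.sq_sqrt hnn, hcx, Real.sqrt_one, one_mul] at h1 h2
  by_cases hx0 : x = 0
  · obtain ⟨e, he, hwe⟩ := exists_unit_orthogonal w
    refine ⟨s, e, he, hwe, ?_⟩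
    rw [polarPoint, ← h1, ← h2, hx0]
    simpa [hx0] using hx
  · have hpos : 0 < √(x ⬝ᵥ x) :=
      Real.sqrt_pos.2 (lt_of_le_of_ne hnn fun h => hx0 (dotProduct_self_eq_zero.1 h.symm))
    refine ⟨s, (√(x ⬝ᵥ x))⁻¹ • x, ?_, by simp [hwx], ?_⟩
    · have := Real.mul_self_sqrt hnn
      simp only [smul_dotProduct, dotProduct_smul, smul_eq_mul]
      field_simp
      linarith
    · rw [polarPoint, ← h1, ← h2, map_smul, smul_inv_smul₀ hpos.ne']
      exact hx

theorem exists_orthonormalBasis_frame (hζ : ζ ∈ sph) (hL : ∀ x y, ⟪L x, L y⟫ = x ⬝ᵥ y)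
    (hLζ : ∀ x, ⟪L x, ζ⟫ = 0) {w r : Fin 3 → ℝ} (hw : w ⬝ᵥ w = 1) (hr : r ⬝ᵥ r = 1)
    (hwr : w ⬝ᵥ r = 0) :
    ∃ b : OrthonormalBasis (Fin 4) ℝ E4, ⇑b = ![ζ, L w, L r, L (w ⨯₃ r)] := by
  have hζ1 : ‖ζ‖ = 1 := by simpa [sph] using hζ
  have hζL : ∀ x, ⟪ζ, L x⟫ = 0 := fun x => by rw [real_inner_comm, hLζ]
  have hn := cross_dotProduct_self hw hr hwr
  have hLn : ∀ x, x ⬝ᵥ x = 1 → ‖L x‖ = 1 := fun x hx => by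
    rw [norm_eq_sqrt_real_inner, hL, hx, Real.sqrt_one]
  have ho : Orthonormal ℝ ![ζ, L w, L r, L (w ⨯₃ r)] := by
    rw [orthonormal_iff_ite]
    intro i j
    fin_cases i <;> fin_cases j <;>
      simp [hL, hLζ, hζL, hζ1, hLn, hw, hr, hwr, hn, dotProduct_comm r w, dot_self_cross,
        dot_cross_self, dotProduct_comm (w ⨯₃ r)]
  have ho' : Orthonormal ℝ ((univ : Set (Fin 4)).domRestrict ![ζ, L w, L r, L (w ⨯₃ r)]) :=
    ho.comp _ Subtype.val_injective
  obtain ⟨b, hb⟩ := ho'.exists_orthonormalBasis_extension_of_card_eq (by simp)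
  exact ⟨b, funext fun i => hb i trivial⟩

end

theorem rotation_apply_of_orthonormalBasis (b : OrthonormalBasis (Fin 4) ℝ E4)
    (φ : E4 ≃ₗᵢ[ℝ] E4) (ε : ℝ) (hε : ε ^ 2 = 1) (h0 : φ (b 0) = ε • b 0) (h1 : IsRot (b 1) φ) :
    ∃ α, φ (b 2) = Real.cos α • b 2 + Real.sin α • b 3 ∧
      φ (b 3) = ε • (-Real.sin α • b 2 + Real.cos α • b 3) := by
  have hip : ∀ i j, ⟪φ (b i), φ (b j)⟫ = if i = j then 1 else 0 := fun i j => by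
    rw [φ.inner_map_map, b.inner_eq_ite]
  have hφ0 : ∀ i, i ≠ 0 → ⟪b 0, φ (b i)⟫ = 0 := fun i hi => by
    have := hip 0 i
    rw [h0, inner_smul_left, if_neg hi.symm] at this
    have hε0 : ε ≠ 0 := by rintro rfl; norm_num at hε
    simpa [hε0] using this
  have hφ1 : ∀ i, i ≠ 1 → ⟪b 1, φ (b i)⟫ = 0 := fun i hi => by
    have := hip 1 i
    rwa [h1.1, if_neg hi.symm] at this
  have e2 := b.sum_repr' (φ (b 2))
  have e3 := b.sum_repr' (φ (b 3))
  rw [Fin.sum_univ_four, hφ0 _ (by decide), hφ1 _ (by decide)] at e2 e3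
  have hp := hip 2 2
  have hr := hip 2 3
  have hM : LinearMap.toMatrix b.toBasis b.toBasis (φ.toLinearEquiv : E4 →ₗ[ℝ] E4) =
      !![ε, 0, 0, 0; 0, 1, 0, 0; 0, 0, ⟪b 2, φ (b 2)⟫, ⟪b 2, φ (b 3)⟫;
        0, 0, ⟪b 3, φ (b 2)⟫, ⟪b 3, φ (b 3)⟫] := by
    ext i j
    fin_cases i <;> fin_cases j <;>
      simp [LinearMap.toMatrix_apply, OrthonormalBasis.repr_apply_apply, h0, h1.1, hφ0, hφ1]
  have hdet := h1.2
  rw [← LinearMap.det_toMatrix b.toBasis, hM] at hdet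
  generalize ⟪b 2, φ (b 2)⟫ = x at *
  generalize ⟪b 3, φ (b 2)⟫ = y at *
  generalize ⟪b 2, φ (b 3)⟫ = z at *
  generalize ⟪b 3, φ (b 3)⟫ = t at *
  simp [Matrix.det_succ_row_zero, Fin.sum_univ_succ, Fin.succAbove] at hdet
  simp only [zero_smul, zero_add] at e2 e3
  have hp' : x ^ 2 + y ^ 2 = 1 := by
    rw [← e2] at hp
    simp only [inner_add_left, inner_add_right, inner_smul_left, inner_smul_right,
      b.inner_eq_ite] at hp
    simpa [sq] using hp
  have hr' : z * x + t * y = 0 := by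
    rw [← e2, ← e3] at hr
    simpa [inner_add_left, inner_add_right, inner_smul_left, inner_smul_right,
      b.inner_eq_ite] using hr
  have hd : x * t - z * y = ε := by linear_combination ε * hdet - (x * t - z * y) * hε
  obtain ⟨α, h2, h3⟩ := exists_polar x y
  rw [hp', Real.sqrt_one, one_mul] at h2 h3
  have hz : z = ε * -y := by linear_combination -z * hp' + x * hr' - y * hd
  have ht : t = ε * x := by linear_combination -t * hp' + y * hr' + x * hd
  refine ⟨α, ?_, ?_⟩
  · rw [← h2, ← h3]
    exact e2.symm
  · rw [← h2, ← h3, ← e3, hz, ht]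
    module

theorem exists_halfTurn (b : OrthonormalBasis (Fin 4) ℝ E4) :
    ∃ φ : E4 ≃ₗᵢ[ℝ] E4, IsRot (b 1) φ ∧ φ (b 0) = -b 0 ∧ φ (b 2) = b 2 ∧ φ (b 3) = -b 3 := by
  set K : Submodule ℝ E4 := Submodule.span ℝ {b 1, b 2} with hK
  have hm : ∀ i, i ≠ 1 → i ≠ 2 → b i ∈ Kᗮ := by
    intro i h1 h2
    rw [hK, Submodule.mem_orthogonal]
    intro u hu
    obtain ⟨p, q, rfl⟩ := Submodule.mem_span_pair.1 hu
    simp [inner_add_left, inner_smul_left, b.inner_eq_ite, h1.symm, h2.symm]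
  have hfr : Module.finrank ℝ K = 2 := by
    have hli : LinearIndependent ℝ ![b 1, b 2] := by
      have := b.orthonormal.linearIndependent.comp ![1, 2] (by decide)
      have he : ⇑b ∘ ![1, 2] = ![b 1, b 2] := by
        ext1 i
        fin_cases i <;> rfl
      rwa [he] at this
    have := finrank_span_eq_card hli
    rwa [Matrix.range_cons, Matrix.range_cons, Matrix.range_empty, union_empty,
      singleton_union, Fintype.card_fin] at this
  have hfr' : Module.finrank ℝ Kᗮ = 2 := by
    have := K.finrank_add_finrank_orthogonal
    rw [hfr, finrank_euclideanSpace_fin] at this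
    omega
  refine ⟨K.reflection, ⟨K.reflection_mem_subspace_eq_self (Submodule.subset_span (by simp)), ?_⟩,
    K.reflection_mem_subspace_orthogonalComplement_eq_neg (hm 0 (by decide) (by decide)),
    K.reflection_mem_subspace_eq_self (Submodule.subset_span (by simp)),
    K.reflection_mem_subspace_orthogonalComplement_eq_neg (hm 3 (by decide) (by decide))⟩
  have := K.det_reflection
  rw [hfr'] at this
  simpa using this

theorem polarPoint_neg {ζ : E4} (hζ : ζ ∈ sph) {L : (Fin 3 → ℝ) →ₗ[ℝ] E4}
    (hLζ : ∀ x, ⟪L x, ζ⟫ = 0) (s : ℝ) (x : Fin 3 → ℝ) :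
    polarPoint ζ L s (-x) = Ocal ζ (polarPoint ζ L s x) := by
  have hζ1 : ‖ζ‖ = 1 := by simpa [sph] using hζ
  have : ⟪polarPoint ζ L s x, ζ⟫ = Real.cos s := by
    simp [polarPoint, inner_add_left, inner_smul_left, hLζ, hζ1]
  rw [Ocal, this, polarPoint, polarPoint, map_neg]
  module

/-- A rotation about `L w` that preserves the line spanned by `ζ` acts on the circles of latitude
as a rotation or as a reflection. -/
theorem rotOrRefl_of_isRot {ζ : E4} (hζ : ζ ∈ sph) {L : (Fin 3 → ℝ) →ₗ[ℝ] E4}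
    (hL : ∀ x y, ⟪L x, L y⟫ = x ⬝ᵥ y) (hLζ : ∀ x, ⟪L x, ζ⟫ = 0) {f g : E4 → ℝ}
    {w r : Fin 3 → ℝ} (hw : w ⬝ᵥ w = 1) (hr : r ⬝ᵥ r = 1) (hwr : w ⬝ᵥ r = 0)
    (φ : E4 ≃ₗᵢ[ℝ] E4) (hφ : IsRot (L w) φ) (hφζ : φ ζ = ζ ∨ φ ζ = -ζ)
    (hfg : ∀ θ ∈ S2 (L w), f (φ θ) = g θ) :
    RotOrRefl (fun s x => f (polarPoint ζ L s x)) (fun s x => g (polarPoint ζ L s x)) w r := by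
  obtain ⟨b, hb⟩ := exists_orthonormalBasis_frame hζ hL hLζ hw hr hwr
  have hmem : ∀ s τ, polarPoint ζ L s (circ w r τ) ∈ S2 (L w) := fun s τ =>
    polarPoint_mem_S2 hζ hL hLζ (circ_dotProduct_self hw hr hwr τ) (dotProduct_circ hwr τ) s
  have hb0 : b 0 = ζ := congrFun hb 0
  have hb1 : b 1 = L w := congrFun hb 1
  have hb2 : b 2 = L r := congrFun hb 2
  have hb3 : b 3 = L (w ⨯₃ r) := congrFun hb 3
  rcases hφζ with h0 | h0
  · obtain ⟨α, h2, h3⟩ := rotation_apply_of_orthonormalBasis b φ 1 (by norm_num)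
      (by rw [hb0, h0, one_smul]) (by rwa [hb1])
    refine Or.inl ⟨α, fun s τ => ?_⟩
    refine Eq.trans (congrArg f ?_) (hfg _ (hmem s τ))
    rw [hb2, hb3] at h2 h3
    simp only [polarPoint, circ, map_add, map_smul, h0, h2, h3, Real.cos_add, Real.sin_add]
    module
  · obtain ⟨β, h2, h3⟩ := rotation_apply_of_orthonormalBasis b φ (-1) (by norm_num)
      (by rw [hb0, h0, neg_one_smul]) (by rwa [hb1])
    refine Or.inr ⟨β, fun s τ => ?_⟩
    refine Eq.trans (congrArg f ?_) (hfg _ (hmem s τ))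
    rw [hb2, hb3] at h2 h3
    simp only [polarPoint, circ, map_add, map_smul, h0, h2, h3, Real.cos_sub, Real.sin_sub,
      Real.cos_pi, Real.sin_pi]
    module

theorem exists_continuous_eqOn {f : E4 → ℝ} (hf : ContinuousOn f sph) :
    ∃ F : E4 → ℝ, Continuous F ∧ ∀ θ ∈ sph, F θ = f θ := by
  obtain ⟨F, hF⟩ := ContinuousMap.exists_restrict_eq (s := sph) Metric.isClosed_sphere
    ⟨sph.domRestrict f, hf.domRestrict⟩
  exact ⟨F, F.continuous, fun θ hθ => DFunLike.congr_fun hF ⟨θ, hθ⟩⟩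

theorem continuous_polarPoint {ζ : E4} {L : (Fin 3 → ℝ) →ₗ[ℝ] E4} :
    Continuous fun q : ℝ × (Fin 3 → ℝ) => polarPoint ζ L q.1 q.2 := by
  have hL := L.continuous_of_finiteDimensional
  simp only [polarPoint]
  fun_prop

theorem mem_Psi_of_mem_reflSet {ζ : E4} (hζ : ζ ∈ sph) {L : (Fin 3 → ℝ) →ₗ[ℝ] E4}
    (hL : ∀ x y, ⟪L x, L y⟫ = x ⬝ᵥ y) (hLζ : ∀ x, ⟪L x, ζ⟫ = 0)
    (hθ : ∀ θ, ∃ x, θ = ⟪θ, ζ⟫ • ζ + L x) {f g : E4 → ℝ} {w : Fin 3 → ℝ} (hwζ : L w ∈ S2 ζ)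
    (h : w ∈ reflSet (fun s x => f (polarPoint ζ L s x)) (fun s x => g (polarPoint ζ L s x))) :
    L w ∈ Psi f g ζ := by
  obtain ⟨hw, r, hr, hwr, h⟩ := h
  obtain ⟨b, hb⟩ := exists_orthonormalBasis_frame hζ hL hLζ hw hr hwr
  have hb0 : b 0 = ζ := congrFun hb 0
  have hb1 : b 1 = L w := congrFun hb 1
  have hb2 : b 2 = L r := congrFun hb 2
  have hb3 : b 3 = L (w ⨯₃ r) := congrFun hb 3
  obtain ⟨φ, hφ, h0, h2, h3⟩ := exists_halfTurn b
  rw [hb0] at h0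
  rw [hb1] at hφ
  rw [hb2] at h2
  rw [hb3] at h3
  refine ⟨hwζ, φ, hφ, h0, fun θ hθw => ?_⟩
  obtain ⟨s, x, hx, hwx, rfl⟩ := exists_eq_polarPoint hζ hL hLζ hθ hθw
  obtain ⟨τ, rfl⟩ := exists_eq_circ hw hr hwr hx hwx
  refine Eq.trans (congrArg f ?_) (h s τ)
  simp only [polarPoint, circ, map_add, map_smul, h0, h2, h3, Real.cos_pi_sub, Real.sin_pi_sub,
    Real.cos_neg, Real.sin_neg]
  module

/-- Lemma: `S²(ζ) = Ξ₀ ∪ Ξ₁ ∪ Ψ`. -/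
theorem stmt_6 (ζ : E4) (hζ : ζ ∈ sph) (f g : E4 → ℝ)
    (hf : ContinuousOn f sph) (hg : ContinuousOn g sph)
    (hfodd : ∀ θ ∈ sph, f (Ocal ζ θ) = - f θ)
    (hgodd : ∀ θ ∈ sph, g (Ocal ζ θ) = - g θ)
    (hrot : ∀ w ∈ S2 ζ, ∃ φ : E4 ≃ₗᵢ[ℝ] E4,
      IsRot w φ ∧ (φ ζ = ζ ∨ φ ζ = -ζ) ∧ ∀ θ ∈ S2 w, f (φ θ) = g θ) :
    S2 ζ = Xi0 f g ζ ∪ Xi1 f g ζ ∪ Psi f g ζ := by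
  obtain ⟨L, hL, hLζ, hθ⟩ := exists_linearMap_orthogonal ζ hζ
  obtain ⟨f', hf', hff⟩ := exists_continuous_eqOn hf
  obtain ⟨g', hg', hgg⟩ := exists_continuous_eqOn hg
  have hmem : ∀ s x, x ⬝ᵥ x = 1 → polarPoint ζ L s x ∈ sph := fun s x hx =>
    (polarPoint_mem_S2 (w := 0) hζ hL hLζ hx (zero_dotProduct x) s).1
  set F : ℝ → (Fin 3 → ℝ) → ℝ := fun s x => f' (polarPoint ζ L s x) with hF
  set G : ℝ → (Fin 3 → ℝ) → ℝ := fun s x => g' (polarPoint ζ L s x) with hG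
  have hFf : ∀ s x, x ⬝ᵥ x = 1 → F s x = f (polarPoint ζ L s x) := fun s x hx =>
    hff _ (hmem s x hx)
  have hGg : ∀ s x, x ⬝ᵥ x = 1 → G s x = g (polarPoint ζ L s x) := fun s x hx =>
    hgg _ (hmem s x hx)
  have hneg : ∀ x : Fin 3 → ℝ, x ⬝ᵥ x = 1 → -x ⬝ᵥ -x = 1 := fun x hx => by simpa using hx
  have hFodd : ∀ s x, x ⬝ᵥ x = 1 → F s (-x) = -F s x := fun s x hx => by
    rw [hFf _ _ (hneg x hx), hFf _ _ hx, polarPoint_neg hζ hLζ, hfodd _ (hmem s x hx)]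
  have hGodd : ∀ s x, x ⬝ᵥ x = 1 → G s (-x) = -G s x := fun s x hx => by
    rw [hGg _ _ (hneg x hx), hGg _ _ hx, polarPoint_neg hζ hLζ, hgodd _ (hmem s x hx)]
  have hLS : ∀ w, w ⬝ᵥ w = 1 → L w ∈ S2 ζ := fun w hw =>
    ⟨by rw [sph, mem_sphere_zero_iff_norm, norm_eq_sqrt_real_inner, hL, hw, Real.sqrt_one], hLζ w⟩
  have hmain := mem_rotSet_or_mem_reflSet (F := F) (G := G) (hf'.comp continuous_polarPoint)
    (hg'.comp continuous_polarPoint) hFodd hGodd fun w r hw hr hwr => by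
      obtain ⟨φ, hφ, hφζ, hfg⟩ := hrot (L w) (hLS w hw)
      refine rotOrRefl_of_isRot hζ hL hLζ hw hr hwr φ hφ hφζ fun θ hθw => ?_
      have hφθ : φ θ ∈ sph := by
        have := hθw.1
        rw [sph, mem_sphere_zero_iff_norm] at this ⊢
        rw [φ.norm_map, this]
      rw [hff _ hφθ, hgg _ hθw.1, hfg θ hθw]
  refine Subset.antisymm (fun W hW => ?_) ?_
  · obtain ⟨w, hw⟩ := hθ W
    rw [hW.2, zero_smul, zero_add] at hw
    subst hw
    have hw1 : w ⬝ᵥ w = 1 := by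
      have : ‖L w‖ = 1 := by simpa [sph] using hW.1
      rw [← hL, real_inner_self_eq_norm_sq, this, one_pow]
    rcases hmain w hw1 with (h | h) | h
    · refine Or.inl (Or.inl ⟨hW, fun θ hθw => ?_⟩)
      obtain ⟨s, x, hx, hwx, rfl⟩ := exists_eq_polarPoint hζ hL hLζ hθ hθw
      have := (mem_rotSet_iff.1 h).2 x hx hwx s
      rwa [circ_zero, hFf s x hx, hGg s x hx] at this
    · refine Or.inl (Or.inr ⟨hW, fun θ hθw => ?_⟩)
      obtain ⟨s, x, hx, hwx, rfl⟩ := exists_eq_polarPoint hζ hL hLζ hθ hθw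
      have := (mem_rotSet_iff.1 h).2 x hx hwx s
      rw [← zero_add Real.pi, circ_add_pi, circ_zero, hFodd s x hx, hFf s x hx, hGg s x hx] at this
      rw [hgodd _ hθw.1, ← this, neg_neg]
    · obtain ⟨-, φ, hφ, hφζ, hfg⟩ := mem_Psi_of_mem_reflSet hζ hL hLζ hθ hW h
      refine Or.inr ⟨hW, φ, hφ, hφζ, fun θ hθw => ?_⟩
      have hφθ : φ θ ∈ sph := by
        have := hθw.1
        rw [sph, mem_sphere_zero_iff_norm] at this ⊢
        rw [φ.norm_map, this]
      rw [← hff _ hφθ, ← hgg _ hθw.1, hfg θ hθw]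
  · exact union_subset (union_subset (fun _ h => h.1) fun _ h => h.1) fun _ h => h.1
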